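/- Let s be a positive integer, q_0 = 3^s, q = 3·q_0², and let F_{q⁶} be the finite field with q⁶ elements. Then the number of triples (a,b,c) ∈ F_{q⁶}³ satisfying b^q − b = a^{q_0}·(a^q − a) and c^q − c = a^{2q_0}·(a^q − a) equals q⁶ + 3·q_0·q³·(q − 1)·(q + q_0 + 1). -/

import Mathlib

/-- Two commuting endomorphisms `σ` and `τ` which behave like `x ↦ x ^ q` and `x ↦ x ^ (3 q₀)`
on the field with `q ^ 6` elements, `q = 3 q₀ ^ 2`. -/
structure IsReePair {F : Type*} [Field F] (σ τ : F →+* F) : Prop where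
  comm : ∀ x, τ (σ x) = σ (τ x)
  sq : ∀ x, τ (τ x) = σ x ^ 3
  six : ∀ x, σ (σ (σ (σ (σ (σ x))))) = x

/-- The trace to the field fixed by `σ`. -/
def cyclicTrace {F : Type*} [Field F] (σ : F →+* F) (x : F) : F :=
  x + σ x + σ (σ x) + σ (σ (σ x)) + σ (σ (σ (σ x))) + σ (σ (σ (σ (σ x))))

/-- The `x`-coordinates of the affine points of the Ree curve, after applying `τ`. -/
def IsAbscissa {F : Type*} [Field F] (σ τ : F →+* F) (a : F) : Prop :=
  cyclicTrace σ (τ (σ a - a) * σ a) = 0 ∧ cyclicTrace σ (τ (σ a - a) * σ a ^ 2) = 0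

theorem pair_sum_mul_vandermonde {F : Type*} [Field F] {x1 x2 x3 x4 x5 x0 d12 d13 d14 d15 d10 d23 d24 d25 d20 d34 d35 d30
    d45 d40 d50 l1 l2 l3 l4 l5 l0 : F}
    (h1 : l1 = x1*(d12*d13*d14*d15*d10)) (h2 : l2 = x2*(-d12*d23*d24*d25*d20))
    (h3 : l3 = x3*(d13*d23*d34*d35*d30)) (h4 : l4 = x4*(-d14*d24*d34*d45*d40))
    (h5 : l5 = x5*(d15*d25*d35*d45*d50)) (h0 : l0 = x0*(-d10*d20*d30*d40*d50)) :
    -l1*l2*d12^2*(d34*d35*d30*d45*d40*d50) + l1*l3*d13^2*(d24*d25*d20*d45*d40*d50)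
    -l1*l4*d14^2*(d23*d25*d20*d35*d30*d50) + l1*l5*d15^2*(d23*d24*d20*d34*d30*d40)
    -l1*l0*d10^2*(d23*d24*d25*d34*d35*d45) - l2*l3*d23^2*(d14*d15*d10*d45*d40*d50)
    +l2*l4*d24^2*(d13*d15*d10*d35*d30*d50) - l2*l5*d25^2*(d13*d14*d10*d34*d30*d40)
    +l2*l0*d20^2*(d13*d14*d15*d34*d35*d45) - l3*l4*d34^2*(d12*d15*d10*d25*d20*d50)
    +l3*l5*d35^2*(d12*d14*d10*d24*d20*d40) - l3*l0*d30^2*(d12*d14*d15*d24*d25*d45)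
    -l4*l5*d45^2*(d12*d13*d10*d23*d20*d30) + l4*l0*d40^2*(d12*d13*d15*d23*d25*d35)
    -l5*l0*d50^2*(d12*d13*d14*d23*d24*d34)
    = (d12*d13*d14*d15*d10*d23*d24*d25*d20*d34*d35*d30*d45*d40*d50) *
      (x1*x2*d12^3 + x1*x3*d13^3 + x1*x4*d14^3 + x1*x5*d15^3 + x1*x0*d10^3 + x2*x3*d23^3 + x2*x4*d24^3
       + x2*x5*d25^3 + x2*x0*d20^3 + x3*x4*d34^3 + x3*x5*d35^3 + x3*x0*d30^3 + x4*x5*d45^3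
       + x4*x0*d40^3 + x5*x0*d50^3) := by
  subst h1 h2 h3 h4 h5 h0
  ring

section Algebra

variable {F : Type*} [Field F] [CharP F 3]

theorem cube_sub_char_three (x y : F) : (x - y) ^ 3 = x ^ 3 - y ^ 3 := by grind

theorem cube_add_char_three (x y : F) : (x + y) ^ 3 = x ^ 3 + y ^ 3 := by grind

set_option maxRecDepth 100000 in
theorem vandermonde_pair_sum_of_zero (a1 a2 a3 a4 a5 u v : F) :
    -(u*a1+v)*(u*a2+v)*(a1-a2)^2*((a3-a4)*(a3-a5)*a3*(a4-a5)*a4*a5)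
    +(u*a1+v)*(u*a3+v)*(a1-a3)^2*((a2-a4)*(a2-a5)*a2*(a4-a5)*a4*a5)
    -(u*a1+v)*(u*a4+v)*(a1-a4)^2*((a2-a3)*(a2-a5)*a2*(a3-a5)*a3*a5)
    +(u*a1+v)*(u*a5+v)*(a1-a5)^2*((a2-a3)*(a2-a4)*a2*(a3-a4)*a3*a4)
    -(u*a1+v)*v*a1^2*((a2-a3)*(a2-a4)*(a2-a5)*(a3-a4)*(a3-a5)*(a4-a5))
    -(u*a2+v)*(u*a3+v)*(a2-a3)^2*((a1-a4)*(a1-a5)*a1*(a4-a5)*a4*a5)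
    +(u*a2+v)*(u*a4+v)*(a2-a4)^2*((a1-a3)*(a1-a5)*a1*(a3-a5)*a3*a5)
    -(u*a2+v)*(u*a5+v)*(a2-a5)^2*((a1-a3)*(a1-a4)*a1*(a3-a4)*a3*a4)
    +(u*a2+v)*v*a2^2*((a1-a3)*(a1-a4)*(a1-a5)*(a3-a4)*(a3-a5)*(a4-a5))
    -(u*a3+v)*(u*a4+v)*(a3-a4)^2*((a1-a2)*(a1-a5)*a1*(a2-a5)*a2*a5)
    +(u*a3+v)*(u*a5+v)*(a3-a5)^2*((a1-a2)*(a1-a4)*a1*(a2-a4)*a2*a4)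
    -(u*a3+v)*v*a3^2*((a1-a2)*(a1-a4)*(a1-a5)*(a2-a4)*(a2-a5)*(a4-a5))
    -(u*a4+v)*(u*a5+v)*(a4-a5)^2*((a1-a2)*(a1-a3)*a1*(a2-a3)*a2*a3)
    +(u*a4+v)*v*a4^2*((a1-a2)*(a1-a3)*(a1-a5)*(a2-a3)*(a2-a5)*(a3-a5))
    -(u*a5+v)*v*a5^2*((a1-a2)*(a1-a3)*(a1-a4)*(a2-a3)*(a2-a4)*(a3-a4))
    = ((u*a4+v)*(u*a5+v)*(a1-a3)*a2-(u*a1+v)*(u*a2+v)*a4*(a5-a3))*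
      ((a1-a2)*(a2-a3)*(a3-a4)*(a4-a5)*a5*(-a1)) := by grind

theorem cross_relation {a0 a1 a2 a3 a4 a5 x0 x1 x2 x3 x4 x5 u v : F}
    (h12 : a1 ≠ a2) (h23 : a2 ≠ a3) (h34 : a3 ≠ a4) (h45 : a4 ≠ a5) (h50 : a5 ≠ a0) (h01 : a0 ≠ a1)
    (hl1 : u*a1+v = x1*((a1-a2)*(a1-a3)*(a1-a4)*(a1-a5)*(a1-a0)))
    (hl2 : u*a2+v = x2*((a2-a1)*(a2-a3)*(a2-a4)*(a2-a5)*(a2-a0)))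
    (hl3 : u*a3+v = x3*((a3-a1)*(a3-a2)*(a3-a4)*(a3-a5)*(a3-a0)))
    (hl4 : u*a4+v = x4*((a4-a1)*(a4-a2)*(a4-a3)*(a4-a5)*(a4-a0)))
    (hl5 : u*a5+v = x5*((a5-a1)*(a5-a2)*(a5-a3)*(a5-a4)*(a5-a0)))
    (hl0 : u*a0+v = x0*((a0-a1)*(a0-a2)*(a0-a3)*(a0-a4)*(a0-a5)))
    (hB : x1*x2*(a1-a2)^3 + x1*x3*(a1-a3)^3 + x1*x4*(a1-a4)^3 + x1*x5*(a1-a5)^3 + x1*x0*(a1-a0)^3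
      + x2*x3*(a2-a3)^3 + x2*x4*(a2-a4)^3 + x2*x5*(a2-a5)^3 + x2*x0*(a2-a0)^3 + x3*x4*(a3-a4)^3
      + x3*x5*(a3-a5)^3 + x3*x0*(a3-a0)^3 + x4*x5*(a4-a5)^3 + x4*x0*(a4-a0)^3 + x5*x0*(a5-a0)^3 = 0) :
    (u*a4+v)*(u*a5+v)*(a1-a3)*(a2-a0) = (u*a1+v)*(u*a2+v)*(a4-a0)*(a5-a3) := by
  have key := vandermonde_pair_sum_of_zero (a1-a0) (a2-a0) (a3-a0) (a4-a0) (a5-a0) u (u*a0+v)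
  have e (x y : F) : (x - a0) - (y - a0) = x - y := by ring
  have e' (x : F) : u*(x-a0)+(u*a0+v) = u*x+v := by ring
  simp only [e, e'] at key
  rw [pair_sum_mul_vandermonde (x1 := x1) (x2 := x2) (x3 := x3) (x4 := x4) (x5 := x5) (x0 := x0),
    hB, mul_zero] at key
  · have hne : (a1-a2)*(a2-a3)*(a3-a4)*(a4-a5)*(a5-a0)*(-(a1-a0)) ≠ 0 := by
      simp only [ne_eq, mul_eq_zero, sub_eq_zero, neg_eq_zero]
      tauto
    exact sub_eq_zero.1 ((mul_eq_zero.1 key.symm).resolve_right hne)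
  · rw [hl1]
  · rw [hl2]; ring
  · rw [hl3]; ring
  · rw [hl4]; ring
  · rw [hl5]; ring
  · rw [hl0]; ring

end Algebra

theorem slope_eq {F : Type*} [Field F]
    {a1 a2 a3 a4 a5 a0 x1 x2 x3 x4 x5 x0 : F}
    (h0 : x1 + x2 + x3 + x4 + x5 + x0 = 0)
    (h1 : x1*a1 + x2*a2 + x3*a3 + x4*a4 + x5*a5 + x0*a0 = 0)
    (h2 : x1*a1^2 + x2*a2^2 + x3*a3^2 + x4*a4^2 + x5*a5^2 + x0*a0^2 = 0)
    (h3 : x1*a1^3 + x2*a2^3 + x3*a3^3 + x4*a4^3 + x5*a5^3 + x0*a0^3 = 0) :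
    x1*((a1-a4)*(a1-a5)*(a1-a0)) + x2*((a2-a4)*(a2-a5)*(a2-a0)) + x3*((a3-a4)*(a3-a5)*(a3-a0)) = 0 := by
  linear_combination h3 - (a4+a5+a0)*h2 + (a4*a5+a4*a0+a5*a0)*h1 - a4*a5*a0*h0

section Algebra

variable {F : Type*} [Field F] [CharP F 3]

theorem pair_sum_eq_zero {a0 a1 a2 a3 a4 a5 x0 x1 x2 x3 x4 x5 p0 p1 p2 p3 p4 p5 : F}
    (h1 : x1 = p1 - p0) (h2 : x2 = p2 - p1) (h3 : x3 = p3 - p2) (h4 : x4 = p4 - p3)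
    (h5 : x5 = p5 - p4) (h0 : x0 = p0 - p5)
    (hQ : (a1-a0)^3*p0 + (a2-a1)^3*p1 + (a3-a2)^3*p2 + (a4-a3)^3*p3 + (a5-a4)^3*p4
      + (a0-a5)^3*p5 = 0)
    (hC : (a1-a0)^3*p0^2 + (a2-a1)^3*p1^2 + (a3-a2)^3*p2^2 + (a4-a3)^3*p3^2 + (a5-a4)^3*p4^2
      + (a0-a5)^3*p5^2 = 0) :
    x1*x2*(a1-a2)^3 + x1*x3*(a1-a3)^3 + x1*x4*(a1-a4)^3 + x1*x5*(a1-a5)^3 + x1*x0*(a1-a0)^3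
      + x2*x3*(a2-a3)^3 + x2*x4*(a2-a4)^3 + x2*x5*(a2-a5)^3 + x2*x0*(a2-a0)^3 + x3*x4*(a3-a4)^3
      + x3*x5*(a3-a5)^3 + x3*x0*(a3-a0)^3 + x4*x5*(a4-a5)^3 + x4*x0*(a4-a0)^3
      + x5*x0*(a5-a0)^3 = 0 := by
  subst h1 h2 h3 h4 h5 h0
  simp only [cube_sub_char_three] at *
  linear_combination hC - 2*p0 * hQ

theorem weights_cubic {a0 a1 a2 a3 a4 a5 p0 p1 p2 p3 p4 p5 : F}
    (hQ : (a1-a0)^3*p0 + (a2-a1)^3*p1 + (a3-a2)^3*p2 + (a4-a3)^3*p3 + (a5-a4)^3*p4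
      + (a0-a5)^3*p5 = 0) :
    (p1-p0)*a1^3 + (p2-p1)*a2^3 + (p3-p2)*a3^3 + (p4-p3)*a4^3 + (p5-p4)*a5^3 + (p0-p5)*a0^3 = 0 := by
  simp only [cube_sub_char_three] at *
  linear_combination -hQ

end Algebra

theorem weights_eq_zero_of_three_nodes {F : Type*} [Field F] {a0 a1 a2 x0 x1 x2 : F}
    (h01 : a0 ≠ a1) (h20 : a2 ≠ a0) (h0 : x0 + x1 + x2 = 0)
    (h1 : x0*a0 + x1*a1 + x2*a2 = 0) (h2 : x0*a0^2 + x1*a1^2 + x2*a2^2 = 0) : x0 = 0 := by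
  have : x0 * ((a0-a1)*(a2-a0)) = 0 := by linear_combination -h2 + (a1+a2)*h1 - a1*a2*h0
  simpa [sub_eq_zero, h01, h20] using this

/-- The element `t ^ ((q + 1) * (q + 1 + 3 q₀))`. -/
def kappa {F : Type*} [Field F] (σ τ : F →+* F) (t : F) : F :=
  t * σ t ^ 2 * σ (σ t) * τ t * σ (τ t)

section Frobenius

variable {F : Type*} [Field F] [CharP F 3] {σ τ : F →+* F}

theorem exists_affine_weights {a0 a1 a2 a3 a4 a5 p0 p1 p2 p3 p4 p5 : F} (n10 : a1 ≠ a0)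
    (n20 : a2 ≠ a0)
    (h1 : a1 = σ a0) (h2 : a2 = σ a1) (h3 : a3 = σ a2) (h4 : a4 = σ a3) (h5 : a5 = σ a4)
    (h0 : σ a5 = a0) (g0 : p0 = τ a0) (g1 : p1 = σ p0) (g2 : p2 = σ p1) (g3 : p3 = σ p2)
    (g4 : p4 = σ p3) (g5 : p5 = σ p4) (g6 : σ p5 = p0) (h : ∀ x, τ (σ x) = σ (τ x))
    (hQ : (p1-p0)*a1 + (p2-p1)*a2 + (p3-p2)*a3 + (p4-p3)*a4 + (p5-p4)*a5 + (p0-p5)*a0 = 0)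
    (hC : (p1-p0)*a1^2 + (p2-p1)*a2^2 + (p3-p2)*a3^2 + (p4-p3)*a4^2 + (p5-p4)*a5^2
      + (p0-p5)*a0^2 = 0)
    (hQ' : (a1-a0)^3*p0 + (a2-a1)^3*p1 + (a3-a2)^3*p2 + (a4-a3)^3*p3 + (a5-a4)^3*p4
      + (a0-a5)^3*p5 = 0)
    (hC' : (a1-a0)^3*p0^2 + (a2-a1)^3*p1^2 + (a3-a2)^3*p2^2 + (a4-a3)^3*p3^2 + (a5-a4)^3*p4^2
      + (a0-a5)^3*p5^2 = 0) :
    a3 ≠ a0 ∧ ∃ u v, σ u = u ∧ σ v = v ∧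
      u*a1+v = (p1-p0)*((a1-a2)*(a1-a3)*(a1-a4)*(a1-a5)*(a1-a0)) ∧
      u*a2+v = (p2-p1)*((a2-a1)*(a2-a3)*(a2-a4)*(a2-a5)*(a2-a0)) ∧
      u*a3+v = (p3-p2)*((a3-a1)*(a3-a2)*(a3-a4)*(a3-a5)*(a3-a0)) ∧
      u*a4+v = (p4-p3)*((a4-a1)*(a4-a2)*(a4-a3)*(a4-a5)*(a4-a0)) ∧
      u*a5+v = (p5-p4)*((a5-a1)*(a5-a2)*(a5-a3)*(a5-a4)*(a5-a0)) ∧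
      u*a0+v = (p0-p5)*((a0-a1)*(a0-a2)*(a0-a3)*(a0-a4)*(a0-a5)) ∧
      (u*a4+v)*(u*a5+v)*(a1-a3)*(a2-a0) = (u*a1+v)*(u*a2+v)*(a4-a0)*(a5-a3) := by
  have hx : p1 - p0 ≠ 0 := by
    intro hp
    refine n10 (τ.injective ?_)
    rw [h1, h, ← g0, ← g1]
    exact sub_eq_zero.1 hp
  have n21 : a2 ≠ a1 := fun e => n10 (σ.injective (by rw [← h2, e, h1]))
  have n32 : a3 ≠ a2 := fun e => n21 (σ.injective (by rw [← h3, e, h2]))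
  have n43 : a4 ≠ a3 := fun e => n32 (σ.injective (by rw [← h4, e, h3]))
  have n54 : a5 ≠ a4 := fun e => n43 (σ.injective (by rw [← h5, e, h4]))
  have n05 : a0 ≠ a5 := fun e => n54 (σ.injective (by rw [h0, e, h5]))
  have n31 : a3 ≠ a1 := fun e => n20 (σ.injective (by rw [← h3, e, h1]))
  have n42 : a4 ≠ a2 := fun e => n31 (σ.injective (by rw [← h4, e, h2]))
  have n53 : a5 ≠ a3 := fun e => n42 (σ.injective (by rw [← h5, e, h3]))
  have n04 : a0 ≠ a4 := fun e => n53 (σ.injective (by rw [h0, e, h4]))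
  have n15 : a1 ≠ a5 := fun e => n04 (σ.injective (by rw [← h1, e, h5]))
  have n30 : a3 ≠ a0 := by
    intro e
    have e4 : a4 = a1 := by rw [h4, e, ← h1]
    have q3 : p3 = p0 := by rw [g3, g2, g1, g0, ← h, ← h, ← h, ← h1, ← h2, ← h3, e]
    have e5 : a5 = a2 := by rw [h5, e4, ← h2]
    have q4 : p4 = p1 := by rw [g4, q3, ← g1]
    have q5 : p5 = p2 := by rw [g5, q4, ← g2]
    rw [e, e4, e5, q3, q4, q5] at hQ hC
    refine hx (weights_eq_zero_of_three_nodes (a0 := a1) (a1 := a2) (a2 := a0) (x1 := p2 - p1)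
      (x2 := p0 - p2) n21.symm n10.symm (by ring) ?_ ?_)
    · grind
    · grind
  have hQ3 := weights_cubic (a0 := a0) (a1 := a1) (a2 := a2) (a3 := a3) (a4 := a4) (a5 := a5)
    (p0 := p0) (p1 := p1) (p2 := p2) (p3 := p3) (p4 := p4) (p5 := p5) hQ'
  have hB := pair_sum_eq_zero (a0 := a0) (a1 := a1) (a2 := a2) (a3 := a3) (a4 := a4) (a5 := a5)
    (p0 := p0) (p1 := p1) (p2 := p2) (p3 := p3) (p4 := p4) (p5 := p5) rfl rfl rfl rfl rfl rfl
    hQ' hC'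
  have hsl := slope_eq (a1 := a1) (a2 := a2) (a3 := a3) (a4 := a4) (a5 := a5) (a0 := a0)
    (x1 := p1 - p0) (x2 := p2 - p1) (x3 := p3 - p2) (x4 := p4 - p3) (x5 := p5 - p4)
    (x0 := p0 - p5) (by ring) (by linear_combination hQ) (by linear_combination hC) hQ3
  obtain ⟨l1, hl1⟩ : ∃ x, x = (p1 - p0)*((a1-a2)*(a1-a3)*(a1-a4)*(a1-a5)*(a1-a0)) := ⟨_, rfl⟩
  obtain ⟨l2, hl2⟩ : ∃ x, x = (p2 - p1)*((a2-a1)*(a2-a3)*(a2-a4)*(a2-a5)*(a2-a0)) := ⟨_, rfl⟩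
  obtain ⟨l3, hl3⟩ : ∃ x, x = (p3 - p2)*((a3-a1)*(a3-a2)*(a3-a4)*(a3-a5)*(a3-a0)) := ⟨_, rfl⟩
  obtain ⟨l4, hl4⟩ : ∃ x, x = (p4 - p3)*((a4-a1)*(a4-a2)*(a4-a3)*(a4-a5)*(a4-a0)) := ⟨_, rfl⟩
  obtain ⟨l5, hl5⟩ : ∃ x, x = (p5 - p4)*((a5-a1)*(a5-a2)*(a5-a3)*(a5-a4)*(a5-a0)) := ⟨_, rfl⟩
  obtain ⟨l0, hl0⟩ : ∃ x, x = (p0 - p5)*((a0-a1)*(a0-a2)*(a0-a3)*(a0-a4)*(a0-a5)) := ⟨_, rfl⟩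
  have f1 : σ l1 = l2 := by
    rw [hl1, hl2]; simp only [map_mul, map_sub, ← h1, ← h2, ← h3, ← h4, ← h5, h0, ← g1, ← g2]; ring
  have f2 : σ l2 = l3 := by
    rw [hl2, hl3]; simp only [map_mul, map_sub, ← h1, ← h2, ← h3, ← h4, ← h5, h0, ← g3, ← g2]; ring
  have f3 : σ l3 = l4 := by
    rw [hl3, hl4]; simp only [map_mul, map_sub, ← h1, ← h2, ← h3, ← h4, ← h5, h0, ← g3, ← g4]; ring
  have f4 : σ l4 = l5 := by
    rw [hl4, hl5]; simp only [map_mul, map_sub, ← h1, ← h2, ← h3, ← h4, ← h5, h0, ← g5, ← g4]; ring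
  have f5 : σ l5 = l0 := by
    rw [hl5, hl0]; simp only [map_mul, map_sub, ← h1, ← h2, ← h3, ← h4, ← h5, h0, ← g5, g6]; ring
  obtain ⟨u, hu⟩ : ∃ u, u = (l2 - l1) / (a2 - a1) := ⟨_, rfl⟩
  have hu' : u * (a2 - a1) = l2 - l1 := by rw [hu, div_mul_cancel₀ _ (sub_ne_zero.2 n21)]
  have hσu : σ u = u := by
    rw [hu, map_div₀, map_sub, map_sub, f2, f1, ← h2, ← h3, div_eq_div_iff (sub_ne_zero.2 n32)
      (sub_ne_zero.2 n21)]
    linear_combination (-(a1-a2)*(a1-a3)*(a2-a3)) * hsl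
      - (a2-a3)*hl1 + (a1-a3)*hl2 - (a1-a2)*hl3
  obtain ⟨v, hv⟩ : ∃ v, v = l1 - u * a1 := ⟨_, rfl⟩
  have k1 : u * a1 + v = l1 := by rw [hv]; ring
  have k2 : u * a2 + v = l2 := by linear_combination hu' + k1
  have hσv : σ v = v := by
    rw [hv, map_sub, map_mul, hσu, f1, ← h2]; linear_combination -hu'
  have k3 : u * a3 + v = l3 := by simpa only [map_add, map_mul, hσu, hσv, ← h3, f2] using congrArg σ k2
  have k4 : u * a4 + v = l4 := by simpa only [map_add, map_mul, hσu, hσv, ← h4, f3] using congrArg σ k3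
  have k5 : u * a5 + v = l5 := by simpa only [map_add, map_mul, hσu, hσv, ← h5, f4] using congrArg σ k4
  have k0 : u * a0 + v = l0 := by simpa only [map_add, map_mul, hσu, hσv, h0, f5] using congrArg σ k5
  have hR := cross_relation n21.symm n32.symm n43.symm n54.symm n05.symm n10.symm (k1.trans hl1)
    (k2.trans hl2) (k3.trans hl3) (k4.trans hl4) (k5.trans hl5) (k0.trans hl0) hB
  exact ⟨n30, u, v, hσu, hσv, k1.trans hl1, k2.trans hl2, k3.trans hl3, k4.trans hl4, k5.trans hl5,
    k0.trans hl0, hR⟩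

end Frobenius

section Frobenius

variable {F : Type*} [Field F] {σ τ : F →+* F}

/-- If `σ² a = a` then `σ` acts with period two on every `σ`-orbit in sight. -/
theorem isAbscissa_of_sq_fixed [CharP F 3] (h : IsReePair σ τ) {a : F} (ha : σ (σ a) = a) :
    IsAbscissa σ τ a := by
  have hp : σ (σ (τ a)) = τ a := by rw [← h.comm, ← h.comm, ha]
  simp only [IsAbscissa, cyclicTrace, map_sub, map_mul, map_pow, h.comm, ha, hp]
  have h3 : (3 : F) = 0 := mod_cast CharP.cast_eq_zero F 3
  constructor
  · linear_combination ((σ (τ a) - τ a) * σ a + (τ a - σ (τ a)) * a) * h3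
  · linear_combination ((σ (τ a) - τ a) * σ a ^ 2 + (τ a - σ (τ a)) * a ^ 2) * h3

theorem kappa_invariant [CharP F 3] (h : IsReePair σ τ) {a : F} (ha : σ a ≠ a)
    (hA : IsAbscissa σ τ a) :
    σ (σ (σ (kappa σ τ (σ a - a)))) = kappa σ τ (σ a - a) := by
  obtain ⟨hQ, hC⟩ := hA
  have hQ' := congrArg τ hQ
  have hC' := congrArg τ hC
  simp only [cyclicTrace, kappa, map_sub, map_mul, map_pow, map_add, map_zero, h.comm, h.sq]
    at hQ hC hQ' hC' ⊢
  obtain ⟨a1, h1⟩ : ∃ x, x = σ a := ⟨_, rfl⟩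
  obtain ⟨a2, h2⟩ : ∃ x, x = σ a1 := ⟨_, rfl⟩
  obtain ⟨a3, h3⟩ : ∃ x, x = σ a2 := ⟨_, rfl⟩
  obtain ⟨a4, h4⟩ : ∃ x, x = σ a3 := ⟨_, rfl⟩
  obtain ⟨a5, h5⟩ : ∃ x, x = σ a4 := ⟨_, rfl⟩
  have h0 : σ a5 = a := by subst h5 h4 h3 h2 h1; exact h.six a
  obtain ⟨p0, g0⟩ : ∃ x, x = τ a := ⟨_, rfl⟩
  obtain ⟨p1, g1⟩ : ∃ x, x = σ p0 := ⟨_, rfl⟩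
  obtain ⟨p2, g2⟩ : ∃ x, x = σ p1 := ⟨_, rfl⟩
  obtain ⟨p3, g3⟩ : ∃ x, x = σ p2 := ⟨_, rfl⟩
  obtain ⟨p4, g4⟩ : ∃ x, x = σ p3 := ⟨_, rfl⟩
  obtain ⟨p5, g5⟩ : ∃ x, x = σ p4 := ⟨_, rfl⟩
  have g6 : σ p5 = p0 := by subst g5 g4 g3 g2 g1; exact h.six p0
  simp only [← h1, ← h2, ← h3, ← h4, ← h5, h0, ← g0, ← g1, ← g2, ← g3, ← g4, ← g5, g6]
    at hQ hC hQ' hC' ha ⊢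
  by_cases n20 : a2 = a
  · have e3 : a3 = a1 := by rw [h3, n20, h1]
    have e4 : a4 = a := by rw [h4, e3, ← h2, n20]
    have q2 : p2 = p0 := by rw [g2, g1, g0, ← h.comm, ← h.comm, ← h1, ← h2, n20]
    have q3 : p3 = p1 := by rw [g3, q2, ← g1]
    have q4 : p4 = p0 := by rw [g4, q3, ← g2, q2]
    have e5 : a5 = a1 := by rw [h5, e4, ← h1]
    have q5 : p5 = p1 := by rw [g5, q4, ← g1]
    subst e3 e4 e5 q2 q3 q4 q5 n20
    ring
  obtain ⟨n30, u, v, -, -, hl1, hl2, -, hl4, hl5, -, hR⟩ := exists_affine_weights ha n20 h1 h2 h3 h4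
    h5 h0 g0 g1 g2 g3 g4 g5 g6 h.comm hQ hC (by simp only [cube_sub_char_three]; linear_combination hQ')
    (by simp only [cube_sub_char_three]; linear_combination hC')
  rw [hl1, hl2, hl4, hl5] at hR
  have n31 : a3 ≠ a1 := fun e => n20 (σ.injective (by rw [← h3, e, h1]))
  have n42 : a4 ≠ a2 := fun e => n31 (σ.injective (by rw [← h4, e, h2]))
  have n53 : a5 ≠ a3 := fun e => n42 (σ.injective (by rw [← h5, e, h3]))
  have n04 : a ≠ a4 := fun e => n53 (σ.injective (by rw [h0, e, h4]))
  have n15 : a1 ≠ a5 := fun e => n04 (σ.injective (by rw [← h1, e, h5]))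
  have n41 : a4 ≠ a1 := fun e => n30 (σ.injective (by rw [← h4, e, h1]))
  have n52 : a5 ≠ a2 := fun e => n41 (σ.injective (by rw [← h5, e, h2]))
  refine mul_right_cancel₀ (b := (a1-a3)*(a2-a)*(a4-a)*(a5-a3)*(a4-a1)*(a4-a2)*(a5-a1)*(a5-a2)) ?_ ?_
  · simp only [ne_eq, mul_eq_zero, sub_eq_zero]
    tauto
  rw [← neg_sub a2 a1, ← neg_sub a3 a1, ← neg_sub a4 a1, ← neg_sub a5 a1, ← neg_sub a3 a2,
    ← neg_sub a4 a2, ← neg_sub a5 a2, ← neg_sub a5 a4] at hR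
  rw [← neg_sub a3 a1, ← neg_sub a5 a]
  generalize a2 - a1 = d21, a3 - a1 = d31, a4 - a1 = d41, a5 - a1 = d51, a3 - a2 = d32,
    a4 - a2 = d42, a5 - a2 = d52, a5 - a4 = d54, a4 - a3 = d43, a5 - a3 = d53, a1 - a = d1,
    a2 - a = d2, a4 - a = d4, a5 - a = d5 at hR ⊢
  linear_combination hR

/-- Nonzero solutions `ℓ` of the defining equations of the (twisted) Ree ovoid. -/
def IsReeVector (σ τ : F →+* F) (i l : F) : Prop :=
  l ≠ 0 ∧ ∃ μ m n, σ m = m ∧ σ n = n ∧ l * σ μ - σ l * μ = i * τ l ∧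
    l * σ (σ μ) - σ (σ l) * μ = n * σ l - m * σ μ

/-- A square root of `-1` on which `σ` and `τ` act as expected. -/
structure IsImaginaryUnit (σ τ : F →+* F) (i : F) : Prop where
  sq : i ^ 2 = -1
  sigma : σ i = -i
  tau : σ (τ i) = -τ i
  tau_sq : τ i ^ 2 = -1

theorem weight_mul (h : IsReePair σ τ) {i : F} (hi : IsImaginaryUnit σ τ i) {a l : F} (hl : l ≠ 0)
    (ht : (σ a - a) * (l * σ l) = i * τ l) :
    τ (σ a - a) * (l * σ (σ l) * (σ a - a) * (σ (σ a) - σ a)) = τ i * σ l := by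
  have h1 := congrArg σ ht
  have h2 := congrArg τ ht
  simp only [map_mul, map_sub, hi.sigma, h.comm, h.sq] at h1 h2 ⊢
  have hl1 : σ l ≠ 0 := by simpa using hl
  refine mul_right_cancel₀ (pow_ne_zero 2 hl1) ?_
  have e : i ^ 2 = -1 := hi.sq
  linear_combination (σ (τ a) - τ a) * (i * τ l * h1 + (σ (σ a) - σ a) * (σ l * σ (σ l)) * ht) + h2
    - (σ (τ a) - τ a) * τ l * σ (τ l) * e

theorem IsReeVector.exists_abscissa [CharP F 3] (h : IsReePair σ τ) {i : F}
    (hi : IsImaginaryUnit σ τ i) {l : F}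
    (hl : IsReeVector σ τ i l) :
    ∃ a, IsAbscissa σ τ a ∧ (σ a - a) * (l * σ l) = i * τ l := by
  obtain ⟨hl0, μ, m, n, hm, hn, A1, A2⟩ := hl
  obtain ⟨a, rfl⟩ : ∃ a, μ = a * l := ⟨μ / l, by field_simp⟩
  have hl1 : σ l ≠ 0 := by simpa using hl0
  have ht : (σ a - a) * (l * σ l) = i * τ l := by rw [← A1, map_mul]; ring
  refine ⟨a, ?_, ht⟩
  have hw := weight_mul h hi hl0 ht
  have hsum : (σ (σ a) - a) * (l * σ (σ l)) = σ l * (n - m * σ a) := by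
    simp only [map_mul] at A2
    linear_combination A2
  by_cases hmn : m = 0 ∧ n = 0
  · apply isAbscissa_of_sq_fixed h
    have hl2 : σ (σ l) ≠ 0 := by simpa using hl0
    simpa [hmn.1, hmn.2, hl0, hl2, sub_eq_zero] using hsum
  have hi0 : i ≠ 0 := by
    intro h0
    simpa [h0] using hi.sq
  have hτl : τ l ≠ 0 := by simpa using hl0
  have ht0 : σ a - a ≠ 0 := by
    intro h0
    rw [h0, zero_mul] at ht
    exact mul_ne_zero hi0 hτl ht.symm
  obtain ⟨r0, hr0⟩ : ∃ r, r * (σ a - a) = 1 := ⟨(σ a - a)⁻¹, inv_mul_cancel₀ ht0⟩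
  have y0 : τ (σ a - a) * (n - m * σ a) = τ i * (r0 + σ r0) := by
    have hr1 := congrArg σ hr0
    simp only [map_mul, map_sub, map_one] at hr1
    have hl2 : σ (σ l) ≠ 0 := by simpa using hl0
    have : τ (σ a - a) * (n - m * σ a) * ((σ a - a) * (σ (σ a) - σ a)) = τ i * (σ (σ a) - a) := by
      refine mul_right_cancel₀ (mul_ne_zero (mul_ne_zero hl1 hl0) hl2) ?_
      linear_combination σ l * (n - m * σ a) * hw - τ i * σ l * hsum
    linear_combination r0 * σ r0 * this
      - τ (σ a - a) * (n - m * σ a) * (hr1 + (σ (σ a) - σ a) * σ r0 * hr0)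
      + τ i * (σ r0 * hr0 + r0 * hr1)
  simp only [IsAbscissa, cyclicTrace, map_sub, map_mul, map_pow, h.comm]
  rw [map_sub, h.comm] at y0
  have hη := hi.tau
  generalize τ i = η at y0 hη
  have eη : ∀ x, σ (-x) = -σ x := map_neg σ
  have y1 := congrArg σ y0
  have y2 := congrArg σ y1
  have y3 := congrArg σ y2
  have y4 := congrArg σ y3
  have y5 := congrArg σ y4
  have e0 := hr0
  have e1 := congrArg σ e0
  have e2 := congrArg σ e1
  have e3 := congrArg σ e2
  have e4 := congrArg σ e3
  have e5 := congrArg σ e4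
  simp only [map_mul, map_sub, map_one, map_add, map_neg, hm, hn, hη, h.six] at y1 y2 y3 y4 y5 e1 e2 e3 e4 e5 ⊢
  obtain ⟨a1, h1⟩ : ∃ x, x = σ a := ⟨_, rfl⟩
  obtain ⟨a2, h2⟩ : ∃ x, x = σ a1 := ⟨_, rfl⟩
  obtain ⟨a3, h3⟩ : ∃ x, x = σ a2 := ⟨_, rfl⟩
  obtain ⟨a4, h4⟩ : ∃ x, x = σ a3 := ⟨_, rfl⟩
  obtain ⟨a5, h5⟩ : ∃ x, x = σ a4 := ⟨_, rfl⟩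
  obtain ⟨p0, g0⟩ : ∃ x, x = τ a := ⟨_, rfl⟩
  obtain ⟨p1, g1⟩ : ∃ x, x = σ p0 := ⟨_, rfl⟩
  obtain ⟨p2, g2⟩ : ∃ x, x = σ p1 := ⟨_, rfl⟩
  obtain ⟨p3, g3⟩ : ∃ x, x = σ p2 := ⟨_, rfl⟩
  obtain ⟨p4, g4⟩ : ∃ x, x = σ p3 := ⟨_, rfl⟩
  obtain ⟨p5, g5⟩ : ∃ x, x = σ p4 := ⟨_, rfl⟩
  obtain ⟨r1, k1⟩ : ∃ x, x = σ r0 := ⟨_, rfl⟩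
  obtain ⟨r2, k2⟩ : ∃ x, x = σ r1 := ⟨_, rfl⟩
  obtain ⟨r3, k3⟩ : ∃ x, x = σ r2 := ⟨_, rfl⟩
  obtain ⟨r4, k4⟩ : ∃ x, x = σ r3 := ⟨_, rfl⟩
  obtain ⟨r5, k5⟩ : ∃ x, x = σ r4 := ⟨_, rfl⟩
  simp only [← h1, ← h2, ← h3, ← h4, ← h5, ← g0, ← g1, ← g2, ← g3, ← g4, ← g5, ← k1, ← k2, ← k3,
    ← k4, ← k5] at y0 y1 y2 y3 y4 y5 e0 e1 e2 e3 e4 e5 ⊢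
  have z0 : m * ((p1-p0)*a1 + (p2-p1)*a2 + (p3-p2)*a3 + (p4-p3)*a4 + (p5-p4)*a5 + (p0-p5)*a) = 0 := by
    linear_combination -(y0 + y1 + y2 + y3 + y4 + y5)
  have z1 : n * ((p1-p0)*a1 + (p2-p1)*a2 + (p3-p2)*a3 + (p4-p3)*a4 + (p5-p4)*a5 + (p0-p5)*a) = m *
      ((p1-p0)*a1^2 + (p2-p1)*a2^2 + (p3-p2)*a3^2 + (p4-p3)*a4^2 + (p5-p4)*a5^2 + (p0-p5)*a^2) := by
    linear_combination y0*a1 + y1*a2 + y2*a3 + y3*a4 + y4*a5 + y5*a + η*(e0-e1+e2-e3+e4-e5)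
  have z2 : n * ((p1-p0)*a1^2 + (p2-p1)*a2^2 + (p3-p2)*a3^2 + (p4-p3)*a4^2 + (p5-p4)*a5^2
      + (p0-p5)*a^2) = m * ((p1-p0)*a1^3 + (p2-p1)*a2^3 + (p3-p2)*a3^3 + (p4-p3)*a4^3 + (p5-p4)*a5^3
      + (p0-p5)*a^3) := by
    linear_combination y0*a1^2 + y1*a2^2 + y2*a3^2 + y3*a4^2 + y4*a5^2 + y5*a^2
      + η*((a+a1)*e0-(a1+a2)*e1+(a2+a3)*e2-(a3+a4)*e3+(a4+a5)*e4-(a5+a)*e5)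
  have hQ : (p1-p0)*a1 + (p2-p1)*a2 + (p3-p2)*a3 + (p4-p3)*a4 + (p5-p4)*a5 + (p0-p5)*a = 0 := by
    by_cases hm0 : m = 0
    · rw [hm0, zero_mul] at z1
      exact (mul_eq_zero.1 z1).resolve_left fun hn0 => hmn ⟨hm0, hn0⟩
    · exact (mul_eq_zero.1 z0).resolve_left hm0
  refine ⟨by linear_combination hQ, ?_⟩
  by_cases hm0 : m = 0
  · rw [hm0, zero_mul] at z2
    linear_combination (mul_eq_zero.1 z2).resolve_left fun hn0 => hmn ⟨hm0, hn0⟩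
  · rw [hQ, mul_zero] at z1
    linear_combination (mul_eq_zero.1 z1.symm).resolve_left hm0

theorem isReeVector_of_isAbscissa [CharP F 3] (h : IsReePair σ τ) {i : F}
    (hi : IsImaginaryUnit σ τ i) {a l : F}
    (hl : l ≠ 0) (hA : IsAbscissa σ τ a) (ht : (σ a - a) * (l * σ l) = i * τ l) :
    IsReeVector σ τ i l := by
  suffices H : ∃ m n, σ m = m ∧ σ n = n ∧ (σ (σ a) - a) * (l * σ (σ l)) = σ l * (n - m * σ a) by
    obtain ⟨m, n, hm, hn, H⟩ := H
    refine ⟨hl, a * l, m, n, hm, hn, ?_, ?_⟩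
    · rw [map_mul]; linear_combination ht
    · simp only [map_mul]; linear_combination H
  by_cases n20 : σ (σ a) = a
  · exact ⟨0, 0, map_zero σ, map_zero σ, by rw [n20]; ring⟩
  have hi0 : i ≠ 0 := by
    intro h0
    simpa [h0] using hi.sq
  have hτl : τ l ≠ 0 := by simpa using hl
  have ha : σ a ≠ a := by
    intro h0
    rw [h0, sub_self, zero_mul] at ht
    exact mul_ne_zero hi0 hτl ht.symm
  have hw := weight_mul h hi hl ht
  obtain ⟨hQ, hC⟩ := hA
  have hQ' := congrArg τ hQ
  have hC' := congrArg τ hC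
  simp only [cyclicTrace, map_sub, map_mul, map_pow, map_add, map_zero, h.comm, h.sq]
    at hQ hC hQ' hC' hw ⊢
  obtain ⟨a1, h1⟩ : ∃ x, x = σ a := ⟨_, rfl⟩
  obtain ⟨a2, h2⟩ : ∃ x, x = σ a1 := ⟨_, rfl⟩
  obtain ⟨a3, h3⟩ : ∃ x, x = σ a2 := ⟨_, rfl⟩
  obtain ⟨a4, h4⟩ : ∃ x, x = σ a3 := ⟨_, rfl⟩
  obtain ⟨a5, h5⟩ : ∃ x, x = σ a4 := ⟨_, rfl⟩
  have h0 : σ a5 = a := by subst h5 h4 h3 h2 h1; exact h.six a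
  obtain ⟨p0, g0⟩ : ∃ x, x = τ a := ⟨_, rfl⟩
  obtain ⟨p1, g1⟩ : ∃ x, x = σ p0 := ⟨_, rfl⟩
  obtain ⟨p2, g2⟩ : ∃ x, x = σ p1 := ⟨_, rfl⟩
  obtain ⟨p3, g3⟩ : ∃ x, x = σ p2 := ⟨_, rfl⟩
  obtain ⟨p4, g4⟩ : ∃ x, x = σ p3 := ⟨_, rfl⟩
  obtain ⟨p5, g5⟩ : ∃ x, x = σ p4 := ⟨_, rfl⟩
  have g6 : σ p5 = p0 := by subst g5 g4 g3 g2 g1; exact h.six p0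
  simp only [← h1, ← h2, ← h3, ← h4, ← h5, h0, ← g0, ← g1, ← g2, ← g3, ← g4, ← g5, g6]
    at hQ hC hQ' hC' ha n20 hw ⊢
  obtain ⟨n30, u, v, hu, hv, hl1, -, -, -, -, -, hR⟩ := exists_affine_weights ha n20 h1 h2 h3 h4
    h5 h0 g0 g1 g2 g3 g4 g5 g6 h.comm hQ hC (by simp only [cube_sub_char_three]; linear_combination hQ')
    (by simp only [cube_sub_char_three]; linear_combination hC')
  have hR' := congrArg (fun x => σ (σ x)) hR
  simp only [map_add, map_mul, map_sub, hu, hv, ← h1, ← h2, ← h3, ← h4, ← h5, h0] at hR'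
  have n21 : a2 ≠ a1 := fun e => ha (σ.injective (by rw [← h2, e, h1]))
  have n31 : a3 ≠ a1 := fun e => n20 (σ.injective (by rw [← h3, e, h1]))
  have n41 : a4 ≠ a1 := fun e => n30 (σ.injective (by rw [← h4, e, h1]))
  have n15 : a1 ≠ a5 := by
    intro e
    exact n20 (by rw [h2, e, h0])
  have hp : p1 ≠ p0 := by
    intro e
    exact ha (τ.injective (by rw [h1, h.comm, ← g0, ← g1, e]))
  have hL1 : u * a1 + v ≠ 0 := by
    rw [hl1]
    simp only [ne_eq, mul_eq_zero, sub_eq_zero, not_or]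
    exact ⟨hp, ⟨⟨⟨n21.symm, n31.symm⟩, n41.symm⟩, n15⟩, ha⟩
  have hL2 : u * a2 + v ≠ 0 := by
    rw [h2, ← hu, ← hv, ← map_mul, ← map_add]
    exact (map_ne_zero σ).2 hL1
  have hL3 : u * a3 + v ≠ 0 := by
    rw [h3, ← hu, ← hv, ← map_mul, ← map_add]
    exact (map_ne_zero σ).2 hL2
  have n32 : a3 ≠ a2 := fun e => n21 (σ.injective (by rw [← h3, e, h2]))
  have hl1' : σ l ≠ 0 := (map_ne_zero σ).2 hl
  obtain ⟨f, hf⟩ : ∃ f, f * σ l = (a2 - a) * (l * σ (σ l)) := ⟨_, div_mul_cancel₀ _ hl1'⟩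
  have hη := hi.tau
  have K0 : f * (u * a1 + v) = -τ i * ((a2-a)*(a1-a3)*(a1-a4)*(a1-a5)) := by
    refine mul_right_cancel₀ hl1' ?_
    rw [hl1]
    linear_combination (p1-p0)*((a1-a2)*(a1-a3)*(a1-a4)*(a1-a5)*(a1-a))*hf
      - (a1-a3)*(a1-a4)*(a1-a5)*(a2-a)*hw
  have K1 := congrArg σ K0
  simp only [map_add, map_mul, map_sub, map_neg, hη, hu, hv, ← h1, ← h2, ← h3, ← h4, ← h5, h0] at K1
  have K2 := congrArg σ K1
  simp only [map_add, map_mul, map_sub, map_neg, hη, hu, hv, ← h1, ← h2, ← h3, ← h4, ← h5, h0] at K2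
  obtain ⟨m, hm⟩ : ∃ m, m * (a2 - a1) = f - σ f := ⟨_, div_mul_cancel₀ _ (sub_ne_zero.2 n21)⟩
  have hm' := congrArg σ hm
  simp only [map_sub, map_mul, ← h2, ← h3] at hm'
  have hσm : σ m = m := by
    have hne : (a3-a2)*(a2-a1)*((u*a1+v)*(u*a2+v)*(u*a3+v)) ≠ 0 := by
      simp only [ne_eq, mul_eq_zero, sub_eq_zero, not_or]
      exact ⟨⟨n32, n21⟩, ⟨hL1, hL2⟩, hL3⟩
    refine mul_right_cancel₀ hne ?_
    generalize σ m = m', σ (σ f) = f2, σ f = f1, τ i = η at hm hm' K0 K1 K2 ⊢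
    linear_combination (u*a1+v)*(u*a2+v)*(u*a3+v)*(hm'*(a2-a1)-hm*(a3-a2))
      + (a2-a1)*((u*a1+v)*(u*a3+v)*K1-(u*a1+v)*(u*a2+v)*K2)
      - (a3-a2)*((u*a2+v)*(u*a3+v)*K0-(u*a1+v)*(u*a3+v)*K1)
      + η*(a1-a3)*(a1-a2)*(a3-a2)*hR'
  refine ⟨m, f + m * a1, hσm, ?_, ?_⟩
  · rw [map_add, map_mul, hσm, ← h2]
    linear_combination hm
  · linear_combination -hf

end Frobenius

/-- The subfield fixed by `σ`. -/
def fixedSubfield {F : Type*} [Field F] (σ : F →+* F) : Subfield F :=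
  σ.eqLocusField (RingHom.id F)

section Coordinates

variable {F : Type*} [Field F] {σ τ : F →+* F}

theorem mem_fixedSubfield {x : F} : x ∈ fixedSubfield σ ↔ σ x = x := Iff.rfl

@[simp]
theorem map_coe_fixedSubfield (x : fixedSubfield σ) : σ (x : F) = x := x.2

/-- The restriction of `τ` to the field fixed by `σ`. -/
def IsReePair.fixedTau (h : IsReePair σ τ) : fixedSubfield σ →+* fixedSubfield σ :=
  τ.restrict _ _ fun x hx => mem_fixedSubfield.2 <| by rw [← h.comm, mem_fixedSubfield.1 hx]

@[simp]
theorem IsReePair.coe_fixedTau (h : IsReePair σ τ) (x : fixedSubfield σ) :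
    (h.fixedTau x : F) = τ x := rfl

theorem IsReePair.fixedTau_fixedTau (h : IsReePair σ τ) (x : fixedSubfield σ) :
    h.fixedTau (h.fixedTau x) = x ^ 3 := by
  apply Subtype.ext
  simp [h.sq]

/-- A basis datum `1, i, e` for the coordinates of the field over the field fixed by `σ`. -/
structure IsReeFrame (σ τ : F →+* F) (i e : F) (ε g d : fixedSubfield σ) : Prop where
  i_sq : i ^ 2 = -1
  sigma_i : σ i = -i
  tau_i : τ i = ε * i
  eps_sq : ε ^ 2 = 1
  sigma_e : σ e = e + 1
  tau_e : τ e = e + (g - 1)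
  cube_e : e ^ 3 = e + d

/-- The element with given coordinates with respect to `1, i, e, i e, e ^ 2, i e ^ 2`. -/
def reeVec (i e : F) (x x' y y' z z' : fixedSubfield σ) : F :=
  (x + i * x') + (y + i * y') * e + (z + i * z') * e ^ 2

theorem reeVec_add {i e : F} (x x' y y' z z' X X' Y Y' Z Z' : fixedSubfield σ) :
    reeVec i e x x' y y' z z' + reeVec i e X X' Y Y' Z Z' =
      reeVec i e (x + X) (x' + X') (y + Y) (y' + Y') (z + Z) (z' + Z') := by
  simp only [reeVec]
  push_cast
  ring

namespace IsReeFrame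

variable {i e : F} {ε g d : fixedSubfield σ}

theorem isImaginaryUnit (f : IsReeFrame σ τ i e ε g d) : IsImaginaryUnit σ τ i where
  sq := f.i_sq
  sigma := f.sigma_i
  tau := by rw [f.tau_i, map_mul, f.sigma_i, map_coe_fixedSubfield, mul_neg]
  tau_sq := by
    have := congrArg ((↑) : fixedSubfield σ → F) f.eps_sq
    push_cast at this
    rw [f.tau_i, mul_pow, this, f.i_sq, one_mul]

theorem vec_mul (f : IsReeFrame σ τ i e ε g d) (x x' y y' z z' X X' Y Y' Z Z' : fixedSubfield σ) :
    reeVec i e x x' y y' z z' * reeVec i e X X' Y Y' Z Z' =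
      reeVec i e (x*X - x'*X' + d*(y*Z - y'*Z' + z*Y - z'*Y'))
        (x*X' + x'*X + d*(y*Z' + y'*Z + z*Y' + z'*Y))
        (x*Y - x'*Y' + y*X - y'*X' + (y*Z - y'*Z' + z*Y - z'*Y') + d*(z*Z - z'*Z'))
        (x*Y' + x'*Y + y*X' + y'*X + (y*Z' + y'*Z + z*Y' + z'*Y) + d*(z*Z' + z'*Z))
        (x*Z - x'*Z' + y*Y - y'*Y' + z*X - z'*X' + (z*Z - z'*Z'))
        (x*Z' + x'*Z + y*Y' + y'*Y + z*X' + z'*X + (z*Z' + z'*Z)) := by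
  have hi := f.i_sq
  have he := f.cube_e
  simp only [reeVec]
  push_cast
  linear_combination (x'*X' + (x'*Y'+y'*X')*e + (x'*Z'+y'*Y'+z'*X')*e^2 + (y'*Z'+z'*Y')*e^3 + z'*Z'*e^4 : F)*hi
    + ((y*Z - y'*Z' + z*Y - z'*Y' + i*(y*Z' + y'*Z + z*Y' + z'*Y))
      + (z*Z - z'*Z' + i*(z*Z' + z'*Z)) * e)*he

theorem map_vec [CharP F 3] (f : IsReeFrame σ τ i e ε g d) (x x' y y' z z' : fixedSubfield σ) :
    σ (reeVec i e x x' y y' z z') =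
      reeVec i e (x + y + z) (-(x' + y' + z')) (y - z) (-(y' - z')) z (-z') := by
  have h3 : (3 : F) = 0 := mod_cast CharP.cast_eq_zero F 3
  simp only [reeVec, map_add, map_mul, map_pow, f.sigma_e, f.sigma_i, map_coe_fixedSubfield]
  push_cast
  linear_combination ((z:F)-i*z')*e*h3

theorem tau_vec [CharP F 3] (f : IsReeFrame σ τ i e ε g d) (h : IsReePair σ τ)
    (x x' y y' z z' : fixedSubfield σ) :
    τ (reeVec i e x x' y y' z z') =
      reeVec i e (h.fixedTau x + (g-1) * h.fixedTau y + (g-1)^2 * h.fixedTau z)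
        (ε * (h.fixedTau x' + (g-1) * h.fixedTau y' + (g-1)^2 * h.fixedTau z'))
        (h.fixedTau y - (g-1) * h.fixedTau z) (ε * (h.fixedTau y' - (g-1) * h.fixedTau z'))
        (h.fixedTau z) (ε * h.fixedTau z') := by
  have h3 : (3 : F) = 0 := mod_cast CharP.cast_eq_zero F 3
  simp only [reeVec, map_add, map_mul, map_pow, f.tau_e, f.tau_i]
  push_cast
  simp only [h.coe_fixedTau]
  linear_combination (τ z+ε*i*τ z')*(g-1)*e*h3

theorem vec_sub (x x' y y' z z' X X' Y Y' Z Z' : fixedSubfield σ) :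
    reeVec i e x x' y y' z z' - reeVec i e X X' Y Y' Z Z' =
      reeVec i e (x - X) (x' - X') (y - Y) (y' - Y') (z - Z) (z' - Z') := by
  simp only [reeVec]
  push_cast
  ring

theorem vec_smul (c x x' y y' z z' : fixedSubfield σ) :
    (c : F) * reeVec i e x x' y y' z z' =
      reeVec i e (c * x) (c * x') (c * y) (c * y') (c * z) (c * z') := by
  simp only [reeVec]
  push_cast
  ring

theorem i_mul_vec (f : IsReeFrame σ τ i e ε g d) (x x' y y' z z' : fixedSubfield σ) :
    i * reeVec i e x x' y y' z z' = reeVec i e (-x') x (-y') y (-z') z := by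
  have hi := f.i_sq
  simp only [reeVec]
  push_cast
  linear_combination (x' + y' * e + z' * e ^ 2 : F) * hi

theorem two_ne [CharP F 3] : (2 : F) ≠ 0 := by
  have h3 : (3 : F) = 0 := mod_cast CharP.cast_eq_zero F 3
  intro h
  exact one_ne_zero (α := F) (by linear_combination h3 - h)

theorem pair_eq_zero [CharP F 3] (f : IsReeFrame σ τ i e ε g d) {x x' : fixedSubfield σ}
    (h0 : (x + i * x' : F) = 0) : x = 0 ∧ x' = 0 := by
  have h1 := congrArg σ h0
  simp only [map_add, map_mul, f.sigma_i, map_coe_fixedSubfield, map_zero] at h1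
  have h2 : (2 : F) ≠ 0 := two_ne
  have hx : (x : F) = 0 := (mul_eq_zero.1 (by linear_combination h0 + h1 : (2 : F) * x = 0)).resolve_left h2
  have hi : i ≠ 0 := by
    intro hi
    simpa [hi] using f.i_sq
  rw [hx, zero_add] at h0
  exact ⟨by simpa using hx, by simpa [hi] using h0⟩

theorem vec_eq_zero [CharP F 3] (f : IsReeFrame σ τ i e ε g d) {x x' y y' z z' : fixedSubfield σ}
    (h0 : reeVec i e x x' y y' z z' = 0) : x = 0 ∧ x' = 0 ∧ y = 0 ∧ y' = 0 ∧ z = 0 ∧ z' = 0 := by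
  have h3 : (3 : F) = 0 := mod_cast CharP.cast_eq_zero F 3
  have h1 := congrArg (fun t => σ (σ t)) h0
  have h2 := congrArg (fun t => σ (σ t)) h1
  simp only [f.map_vec, map_zero] at h1 h2
  simp only [reeVec] at h0 h1 h2
  push_cast at h0 h1 h2
  obtain ⟨hz, hz'⟩ := f.pair_eq_zero (x := z) (x' := z')
    (by grind)
  simp only [hz, hz', ZeroMemClass.coe_zero] at h0 h1 h2
  obtain ⟨hy, hy'⟩ := f.pair_eq_zero (x := y) (x' := y') (by grind)
  simp only [hy, hy', ZeroMemClass.coe_zero] at h0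
  obtain ⟨hx, hx'⟩ := f.pair_eq_zero (x := x) (x' := x') (by linear_combination h0)
  exact ⟨hx, hx', hy, hy', hz, hz'⟩

theorem vec_inj [CharP F 3] (f : IsReeFrame σ τ i e ε g d) {x x' y y' z z' X X' Y Y' Z Z' : fixedSubfield σ} :
    reeVec i e x x' y y' z z' = reeVec i e X X' Y Y' Z Z' ↔
      x = X ∧ x' = X' ∧ y = Y ∧ y' = Y' ∧ z = Z ∧ z' = Z' := by
  constructor
  · intro h
    rw [← sub_eq_zero, vec_sub] at h
    simpa only [sub_eq_zero] using f.vec_eq_zero h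
  · rintro ⟨rfl, rfl, rfl, rfl, rfl, rfl⟩
    rfl

theorem exists_pair [CharP F 3] (f : IsReeFrame σ τ i e ε g d) {x : F} (hx : σ (σ x) = x) :
    ∃ y y' : fixedSubfield σ, x = y + i * y' := by
  have h3 : (3 : F) = 0 := mod_cast CharP.cast_eq_zero F 3
  have hi := f.i_sq
  refine ⟨⟨-(x + σ x), ?_⟩, ⟨i * (x - σ x), ?_⟩, ?_⟩
  · rw [mem_fixedSubfield, map_neg, map_add, hx, add_comm]
  · rw [mem_fixedSubfield, map_mul, map_sub, hx, f.sigma_i]; ring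
  · simp only
    linear_combination (σ x - x) * hi + x * h3

theorem exists_vec [CharP F 3] (f : IsReeFrame σ τ i e ε g d) (h : IsReePair σ τ) (l : F) :
    ∃ x x' y y' z z' : fixedSubfield σ, l = reeVec i e x x' y y' z z' := by
  have h3 : (3 : F) = 0 := mod_cast CharP.cast_eq_zero F 3
  have h6 := h.six l
  have e2 : σ (σ e) = e - 1 := by
    rw [f.sigma_e, map_add, f.sigma_e, map_one]
    linear_combination h3
  obtain ⟨z, z', hz⟩ := f.exists_pair (x := -(σ (σ (σ (σ l))) - 2 * σ (σ l) + l)) (by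
    simp only [map_neg, map_sub, map_add, map_mul, map_ofNat, h6]
    linear_combination (σ (σ (σ (σ l))) - σ (σ l)) * h3)
  obtain ⟨w, hw⟩ : ∃ w, w = l - (z + i * z') * e ^ 2 := ⟨_, rfl⟩
  have i2 : σ (σ i) = i := by rw [f.sigma_i, map_neg, f.sigma_i, neg_neg]
  have hw2 : σ (σ w) = σ (σ l) - (z + i * z') * (e - 1) ^ 2 := by
    rw [hw]
    simp only [map_sub, map_mul, map_add, map_pow, e2, i2, map_coe_fixedSubfield]
  have hw4 : σ (σ (σ (σ w))) = σ (σ (σ (σ l))) - (z + i * z') * (e - 1 - 1) ^ 2 := by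
    rw [hw2]
    simp only [map_sub, map_mul, map_add, map_pow, map_one, e2, i2, map_coe_fixedSubfield]
  obtain ⟨y, y', hy⟩ := f.exists_pair (x := -(σ (σ w) - w)) (by
    simp only [map_neg, map_sub, hw4]
    rw [hw2, hw]
    linear_combination hz + (z + i * z') * h3)
  obtain ⟨x, x', hx⟩ := f.exists_pair (x := w - (y + i * y') * e) (by
    simp only [map_sub, map_mul, map_add, e2, i2, map_coe_fixedSubfield]
    linear_combination -hy)
  refine ⟨x, x', y, y', z, z', ?_⟩
  rw [reeVec]
  linear_combination hx - hw

end IsReeFrame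

end Coordinates

/-- The real part of `p * conj Q - P * conj q`. -/
def skewRe {k : Type*} [Field k] (p p' P P' q q' Q Q' : k) : k := p*Q + p'*Q' - P*q - P'*q'

/-- The imaginary part of `p * conj Q - P * conj q`. -/
def skewIm {k : Type*} [Field k] (p p' P P' q q' Q Q' : k) : k := p'*Q - p*Q' - P'*q + P*q'

/-- The equations defining a Ree vector, in coordinates. -/
structure ReeSystem {k : Type*} [Field k] (T : k →+* k) (ε g d m n x x' y y' z z' X X' Y Y' Z Z' : k) :
    Prop where
  re2 : skewRe x x' X X' z z' Z Z' + skewRe z z' Z Z' x x' X X' + skewRe y y' Y Y' y y' Y Y'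
    - skewRe y y' Y Y' z z' Z Z' + skewRe z z' Z Z' y y' Y Y' - skewRe z z' Z Z' z z' Z Z' = -ε * T z'
  im2 : skewIm x x' X X' z z' Z Z' + skewIm z z' Z Z' x x' X X' + skewIm y y' Y Y' y y' Y Y'
    - skewIm y y' Y Y' z z' Z Z' + skewIm z z' Z Z' y y' Y Y' - skewIm z z' Z Z' z z' Z Z' = T z
  re1 : (d - 1) * skewRe z z' Z Z' z z' Z Z' - skewRe y y' Y Y' z z' Z Z' + skewRe z z' Z Z' y y' Y Y'
    + skewRe x x' X X' y y' Y Y' + skewRe y y' Y Y' x x' X X' - skewRe x x' X X' z z' Z Z'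
    + skewRe y y' Y Y' y y' Y Y' = -ε * (T y' - (g - 1) * T z')
  im1 : (d - 1) * skewIm z z' Z Z' z z' Z Z' - skewIm y y' Y Y' z z' Z Z' + skewIm z z' Z Z' y y' Y Y'
    + skewIm x x' X X' y y' Y Y' + skewIm y y' Y Y' x x' X X' - skewIm x x' X X' z z' Z Z'
    + skewIm y y' Y Y' y y' Y Y' = T y - (g - 1) * T z
  re0 : d * (skewRe y y' Y Y' z z' Z Z' + skewRe z z' Z Z' y y' Y Y' - skewRe z z' Z Z' z z' Z Z')
    + skewRe x x' X X' x x' X X' + skewRe x x' X X' y y' Y Y' + skewRe x x' X X' z z' Z Z'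
    = -ε * (T x' + (g - 1) * T y' + (g - 1) ^ 2 * T z')
  im0 : d * (skewIm y y' Y Y' z z' Z Z' + skewIm z z' Z Z' y y' Y Y' - skewIm z z' Z Z' z z' Z Z')
    + skewIm x x' X X' x x' X X' + skewIm x x' X X' y y' Y Y' + skewIm x x' X X' z z' Z Z'
    = T x + (g - 1) * T y + (g - 1) ^ 2 * T z
  yz_re : y*Z - y'*Z' - z*Y + z'*Y' = -(n*z - m*Z)
  yz_im : y*Z' + y'*Z - z*Y' - z'*Y = n*z' - m*Z'
  xz_re : x*Z - x'*Z' - z*X + z'*X' = n*y - m*Y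
  xz_im : x*Z' + x'*Z - z*X' - z'*X = -(n*y' - m*Y')
  xy_re : x*Y - x'*Y' - y*X + y'*X' = -(n*x - m*X + n*z - m*Z)
  xy_im : x*Y' + x'*Y - y*X' - y'*X = n*x' - m*X' + n*z' - m*Z'

section Coordinates

variable {F : Type*} [Field F] [CharP F 3] {σ τ : F →+* F} {i e : F} {ε g d : fixedSubfield σ}

instance : CharP (fixedSubfield σ) 3 :=
  ((fixedSubfield σ).subtype.charP_iff (fixedSubfield σ).subtype.injective 3).2 ‹_›

theorem IsReeFrame.system_iff (f : IsReeFrame σ τ i e ε g d) (h : IsReePair σ τ)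
    (m n x x' y y' z z' X X' Y Y' Z Z' : fixedSubfield σ) :
    (reeVec i e x x' y y' z z' * σ (reeVec i e X X' Y Y' Z Z') -
        σ (reeVec i e x x' y y' z z') * reeVec i e X X' Y Y' Z Z' =
        i * τ (reeVec i e x x' y y' z z') ∧
      reeVec i e x x' y y' z z' * σ (σ (reeVec i e X X' Y Y' Z Z')) -
        σ (σ (reeVec i e x x' y y' z z')) * reeVec i e X X' Y Y' Z Z' =
        n * σ (reeVec i e x x' y y' z z') - m * σ (reeVec i e X X' Y Y' Z Z')) ↔
      ReeSystem h.fixedTau ε g d m n x x' y y' z z' X X' Y Y' Z Z' := by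
  rw [f.tau_vec h, f.i_mul_vec, f.map_vec, f.map_vec, f.map_vec, f.map_vec, f.vec_mul, f.vec_mul,
    f.vec_mul, f.vec_mul, vec_sub, vec_sub, vec_smul, vec_smul, vec_sub, f.vec_inj, f.vec_inj]
  have h3 : (3 : fixedSubfield σ) = 0 := mod_cast CharP.cast_eq_zero _ 3
  constructor
  · rintro ⟨⟨a0, a0', a1, a1', a2, a2'⟩, b0, b0', b1, b1', b2, b2'⟩
    constructor
    all_goals try simp only [skewRe, skewIm]
    · linear_combination a2
    · linear_combination a2' + (-2*Z*z' + 2*Z'*z) * h3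
    · linear_combination a1 + (z*Y - Z*y + z'*Y' - Z'*y') * h3
    · linear_combination a1' + (-z'*Y - Z*y' + z*Y' + Z'*y) * h3
    · linear_combination a0
    · linear_combination a0'
    · linear_combination -b2 + (-y*Z + y'*Z' + z*Y - z'*Y') * h3
    · linear_combination -b2' + (-y*Z' - y'*Z + z*Y' + z'*Y) * h3
    · linear_combination b1+b2 + (x*Z + Z*y - x'*Z' - Z'*y' - z*X - z*Y + z'*X' + z'*Y') * h3
    · linear_combination b1'+b2' + (x*Z' + Z'*y + x'*Z + Z*y' - z*X' - z*Y' - z'*X - z'*Y) * h3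
    · linear_combination b1+b2-b0 + (x*Y + x*Z - Y*z - x'*Y' - x'*Z' + Y'*z' - y*X + y*Z - X*z +
        y'*X' - y'*Z' + X'*z') * h3
    · linear_combination b1'+b2'-b0' + (x*Y' + x*Z' - Y'*z + x'*Y + x'*Z - Y*z' - y*X' + y*Z' -
        X'*z - y'*X + y'*Z - X*z') * h3
  · rintro ⟨c2, c2', c1, c1', c0, c0', p, p', q, q', r, r'⟩
    simp only [skewRe, skewIm] at c2 c2' c1 c1' c0 c0'
    refine ⟨⟨?_, ?_, ?_, ?_, ?_, ?_⟩, ?_, ?_, ?_, ?_, ?_, ?_⟩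
    · linear_combination c0
    · linear_combination c0'
    · linear_combination c1 + (-Y*z + Z*y - Y'*z' + Z'*y') * h3
    · linear_combination c1' + (-Y'*z - Z'*y + Y*z' + Z*y') * h3
    · linear_combination c2
    · linear_combination c2' + (-2*Z'*z + 2*Z*z') * h3
    · linear_combination q-r + (x*Y - X*y - x'*Y' + X'*y') * h3
    · linear_combination q'-r' + (x*Y' - X'*y + x'*Y - X*y') * h3
    · linear_combination q+p + (-x*Z + x'*Z' + X*z - X'*z') * h3
    · linear_combination q'+p' + (-x*Z' - x'*Z + X'*z + X*z') * h3
    · linear_combination -p + (-Z*y + Z'*y' + Y*z - Y'*z') * h3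
    · linear_combination -p' + (-Z'*y - Z*y' + Y'*z + Y*z') * h3

end Coordinates

/-- The data witnessing that `l` is a Ree vector. -/
structure IsReeDatum {F : Type*} [Field F] (σ τ : F →+* F) (i l μ m n : F) : Prop where
  map_m : σ m = m
  map_n : σ n = n
  first : l * σ μ - σ l * μ = i * τ l
  second : l * σ (σ μ) - σ (σ l) * μ = n * σ l - m * σ μ

namespace IsReeDatum

variable {F : Type*} [Field F] {σ τ : F →+* F} {i e l μ m n : F}

theorem smul (D : IsReeDatum σ τ i l μ m n) (h : IsReePair σ τ) {c : F} (hc : σ c = c)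
    (hc0 : c ≠ 0) :
    IsReeDatum σ τ i (c * l) (τ c / c * μ) (c * m) (τ c / c * n) := by
  have ht : σ (τ c) = τ c := by rw [← h.comm, hc]
  have h1 := D.first
  have h2 := D.second
  constructor
  · rw [map_mul, hc, D.map_m]
  · rw [map_mul, map_div₀, hc, ht, D.map_n]
  · simp only [map_mul, map_div₀, hc, ht]
    field_simp
    linear_combination τ c * h1
  · simp only [map_mul, map_div₀, hc, ht]
    field_simp
    linear_combination τ c * h2

theorem shift (D : IsReeDatum σ τ i l μ m n) {c : F} (hc : σ c = c) :
    IsReeDatum σ τ i l (μ + c * l) m (n + m * c) := by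
  have h1 := D.first
  have h2 := D.second
  constructor
  · exact D.map_m
  · rw [map_add, map_mul, D.map_m, D.map_n, hc]
  · simp only [map_add, map_mul, hc]
    linear_combination h1
  · simp only [map_add, map_mul, hc]
    linear_combination h2

theorem ratio_not_fixed (D : IsReeDatum σ τ i l μ m n) (hi : i ≠ 0) (hl : l ≠ 0) {c : F}
    (hc : σ c = c) : μ ≠ c * l := by
  rintro rfl
  have h1 := D.first
  rw [map_mul, hc] at h1
  have : i * τ l = 0 := by linear_combination -h1
  rcases mul_eq_zero.1 this with h0 | h0
  · exact hi h0
  · exact hl (by simpa using h0)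

theorem unique (D : IsReeDatum σ τ i l μ m n) {μ' m' n' : F} (D' : IsReeDatum σ τ i l μ' m' n')
    (hi : i ≠ 0) (hl : l ≠ 0) : m = m' := by
  have hl1 : σ l ≠ 0 := by simpa using hl
  have h1 := D.first
  have h2 := D.second
  have h1' := D'.first
  have h2' := D'.second
  obtain ⟨c, rfl⟩ : ∃ c, μ' = μ + c * l := ⟨(μ' - μ) / l, by field_simp; ring⟩
  simp only [map_add, map_mul] at h1' h2'
  have hc : σ c = c := by
    refine mul_right_cancel₀ (mul_ne_zero hl hl1) ?_
    linear_combination h1' - h1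
  simp only [hc] at h1' h2'
  by_contra hne
  have hne' : m - m' ≠ 0 := sub_ne_zero.2 hne
  have key : (m - m') * σ μ = (n - n' + m' * c) * σ l := by
    linear_combination h2 - h2'
  apply D.ratio_not_fixed hi hl (c := (n - n' + m' * c) / (m - m'))
  · simp only [map_div₀, map_sub, map_add, map_mul, D.map_m, D'.map_m, D.map_n, D'.map_n, hc]
  · apply σ.injective
    simp only [map_div₀, map_sub, map_add, map_mul, D.map_m, D'.map_m, D.map_n, D'.map_n, hc]
    field_simp
    linear_combination key

theorem isotropic [CharP F 3] (D : IsReeDatum σ τ i l μ m n) (h : IsReePair σ τ)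
    (hi : IsImaginaryUnit σ τ i)
    (hl : l ≠ 0) :
    l * σ (σ (σ l)) + σ l * σ (σ (σ (σ l))) + σ (σ l) * σ (σ (σ (σ (σ l)))) = -m ^ 2 := by
  have hi0 : i ≠ 0 := by
    intro h0
    simpa [h0] using hi.sq
  have A1 := D.first
  have A2 := D.second
  have hm := D.map_m
  have hn := D.map_n
  obtain ⟨a, rfl⟩ : ∃ a, μ = a * l := ⟨μ / l, by field_simp⟩
  simp only [map_mul] at A1 A2
  have q0 : σ l ≠ 0 := by simpa using hl
  have q1 : σ (σ l) ≠ 0 := by simpa using hl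
  have key : (σ (σ a) - a) * (l * σ (σ l)) = σ l * (n - m * σ a) := by linear_combination A2
  by_cases h20 : σ (σ a) = a
  · have hm0 : m = 0 := by
      by_contra hm0
      rw [h20, sub_self, zero_mul] at key
      have hna : n - m * σ a = 0 := (mul_eq_zero.1 key.symm).resolve_left q0
      refine D.ratio_not_fixed hi0 hl (c := n / m) (by rw [map_div₀, hn, hm]) ?_
      congr 1
      apply σ.injective
      rw [map_div₀, hn, hm]
      field_simp
      linear_combination -hna
    have B1 := congrArg σ A1
    simp only [map_sub, map_mul, hi.sigma, h20] at B1
    have w0 : σ l * σ (σ l) * τ l = l * σ l * σ (τ l) := by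
      refine mul_left_cancel₀ hi0 ?_
      linear_combination (-σ l * σ (σ l)) * A1 - l * σ l * B1
    have w0' : σ (σ l) * τ l = l * σ (τ l) := mul_left_cancel₀ q0 (by linear_combination w0)
    have w1 := congrArg σ w0'
    have wt := congrArg τ w0'
    simp only [map_mul, map_pow, h.comm, h.sq] at w1 wt
    have hne' : σ (τ l) ≠ 0 := by simpa using hl
    have v : σ (σ (σ l)) * σ l ^ 2 = l * σ (σ l) ^ 2 := by
      refine mul_right_cancel₀ (mul_ne_zero (mul_ne_zero hne' q0) q1) ?_
      linear_combination σ l ^ 3 * σ (σ l) * w1 + σ l * σ (σ l) * wt + σ l * σ (σ l) ^ 3 * w0'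
    have v1 := congrArg σ v
    simp only [map_mul, map_pow] at v1
    have u1 : σ l * σ (σ (σ (σ l))) = l * σ (σ (σ l)) := by
      refine mul_right_cancel₀ (pow_ne_zero 2 q1) ?_
      linear_combination σ l * v1 + σ (σ (σ l)) * v
    have u2 := congrArg σ u1
    simp only [map_mul] at u2
    have h3 : (3 : F) = 0 := mod_cast CharP.cast_eq_zero F 3
    rw [hm0]
    linear_combination 2 * u1 + u2 + l * σ (σ (σ l)) * h3
  · have hL : n - m * σ a ≠ 0 := by
      intro hL
      rw [hL, mul_zero] at key
      exact mul_ne_zero (sub_ne_zero.2 h20) (mul_ne_zero hl q1) key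
    have k1 := congrArg σ key
    have k2 := congrArg σ k1
    have k3 := congrArg σ k2
    have k4 := congrArg σ k3
    have k5 := congrArg σ k4
    simp only [map_mul, map_sub, hm, hn, h.six] at k1 k2 k3 k4 k5
    refine mul_right_cancel₀ (mul_ne_zero hL q0) ?_
    linear_combination -σ l * (σ (σ (σ (σ l))) * key + l * k2 + σ (σ l) * k4) + m * l * k1
      - m * σ (σ l) * k5 - m ^ 2 * key

end IsReeDatum

section Coordinates

variable {F : Type*} [Field F] [CharP F 3] {σ τ : F →+* F} {i e : F} {ε g d : fixedSubfield σ}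

theorem IsReeFrame.isotropic (f : IsReeFrame σ τ i e ε g d) (h : IsReePair σ τ)
    {x x' y y' z z' m n : fixedSubfield σ} {μ : F} (hl : reeVec i e x x' y y' z z' ≠ 0)
    (D : IsReeDatum σ τ i (reeVec i e x x' y y' z z') μ m n) :
    x * z + x' * z' = y ^ 2 + y' ^ 2 + z ^ 2 + z' ^ 2 - m ^ 2 := by
  have key := D.isotropic h f.isImaginaryUnit hl
  have hm : -(m : F) ^ 2 = reeVec i e (-m ^ 2) 0 0 0 0 0 := by
    simp only [reeVec]
    push_cast
    ring
  simp only [f.map_vec, f.vec_mul, reeVec_add, hm, f.vec_inj] at key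
  have h3 : (3 : fixedSubfield σ) = 0 := mod_cast CharP.cast_eq_zero _ 3
  have k := key.1
  clear * - k h3
  grind

end Coordinates

section System

variable {k : Type*} [Field k] [hk : CharP k 3] {T : k →+* k} {ε g d : k}

theorem ReeSystem.generic_linear {m n x x' y b α X X' Y Y' ζ A B : k} (hneg : ∀ t : k, t ^ 2 ≠ -1)
    (hε : ε ^ 2 = 1) (hA : A = ε * T α) (hB : B = ε * T b - g * A)
    (S : ReeSystem T ε g d m n x x' y b 1 α X X' Y Y' 0 ζ)
    (iso : x + x' * α = y ^ 2 + b ^ 2 + 1 + α ^ 2 - m ^ 2) :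
    ζ = 1 ∧ n = α * (y + m) - b + A * (1 + α ^ 2) ∧ Y = -n - A ∧ Y' = y + m + α * A ∧
      X = n * (y + m) + m * A + B ∧ X' = (y + m) ^ 2 + A * (α * (y + m) + b) + 1 ∧
      x' = -α * (y + m) ^ 2 + α - b * (y + m) - B
        + A * (y - m - α ^ 2 * (y + m) + α * b) ∧
      x = -α * x' + (y + m) ^ 2 + (y + m) * m + b ^ 2 + 1 + α ^ 2 := by
  obtain ⟨re2, im2, re1, im1, re0, im0, p, p', q, q', r, r'⟩ := S
  simp only [skewRe, skewIm, map_one] at re2 im2 re1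
  have hα : T α = ε * A := by rw [hA]; linear_combination -T α * hε
  have hb : T b = ε * (B + g * A) := by rw [hB]; linear_combination -T b * hε
  rw [hα] at re2 re1
  rw [hb] at re1
  have e1 : b * ζ - Y - Y' * α = -A := by clear * - re2 hε hk; grind
  have hY : Y = -n - A := by clear * - e1 p hk; grind
  have hY' : Y' = ζ * (y + m) + α * A := by subst hY; clear * - p' hk; grind
  have hn : n = ζ * (α * (y + m) - b) + A * (1 + α ^ 2) := by
    subst hY hY'; clear * - p hk; grind
  have e2 : x' * ζ - X - X' * α = B := by clear * - re1 e1 hε hk; grind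
  have hX : X = B + n * y - m * Y := by clear * - e2 q hk; grind
  have hX' : X' = x * ζ - α * X + n * b - m * Y' := by clear * - q' hk; grind
  have e3 : -(x * ζ) - X' + X * α + (b * Y - y * Y') + ζ = -1 := by clear * - im2 hk; grind
  have hα1 : 1 + α ^ 2 ≠ 0 := fun h0 => hneg α (by linear_combination h0)
  have hX2 : X' = -1 - ζ + (y + m) * Y' + b * A := by
    subst hX' hY; clear * - e3 hk; grind
  have e5 : x * ζ = X' + α * X - n * b + m * Y' := by linear_combination -hX'
  have e6 : x' * ζ = B + X + X' * α := by linear_combination e2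
  have hζ : ζ = 1 := by
    refine mul_right_cancel₀ hα1 ?_
    subst hX2 hX hY hY' hn
    linear_combination (norm := (clear * - hk; grind)) ζ * iso - e5 - α * e6
  subst hζ
  rw [mul_one] at e5 e6
  have hX'' : X' = (y + m) ^ 2 + A * (α * (y + m) + b) + 1 := by
    subst hX2 hY'; clear * - hk; grind
  have hX3 : X = n * (y + m) + m * A + B := by
    subst hX hY; clear * - hk; grind
  refine ⟨rfl, by rw [hn, one_mul], hY, by rw [hY', one_mul], hX3, hX'', ?_, ?_⟩
  · subst hX'' hX3 hn
    linear_combination (norm := (clear * - hk; grind)) e6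
  · linear_combination (norm := (clear * - hk; grind)) iso

theorem ReeSystem.generic {m n x x' y b α X X' Y Y' ζ A B : k} (hneg : ∀ t : k, t ^ 2 ≠ -1)
    (hT : ∀ t, T (T t) = t ^ 3) (hε : ε ^ 2 = 1) (hTε : T ε = ε) (hg : T g = d - g)
    (hno : ∀ t, T t ≠ t + g) (hA : A = ε * T α) (hB : B = ε * T b - g * A)
    (S : ReeSystem T ε g d m n x x' y b 1 α X X' Y Y' 0 ζ)
    (iso : x + x' * α = y ^ 2 + b ^ 2 + 1 + α ^ 2 - m ^ 2) :
    m = T (y + m) - (y + m) + α ^ 2 * (y + m) - α * b + α ^ 3 * A - g := by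
  obtain ⟨rfl, hn, hY, hY', hX, hX', hx', hx⟩ := S.generic_linear hneg hε hA hB iso
  obtain ⟨-, -, -, im1, -, im0, -⟩ := S
  have hα : T α = ε * A := by rw [hA]; linear_combination -T α * hε
  have hb : T b = ε * (B + g * A) := by rw [hB]; linear_combination -T b * hε
  have hTA : T A = ε * α ^ 3 := by rw [hA, map_mul, hTε, hT]
  have hTB : T B = ε * b ^ 3 - (d - g) * (ε * α ^ 3) := by
    rw [hB, map_sub, map_mul, map_mul, hTε, hT, hg, hTA]
  obtain ⟨M, rfl⟩ : ∃ M, y = M - m := ⟨y + m, by ring⟩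
  simp only [sub_add_cancel] at *
  obtain ⟨δ, hδ⟩ : ∃ δ, δ = m - (T M - M + α ^ 2 * M - α * b + α ^ 3 * A - g) := ⟨_, rfl⟩
  have hTM : T M = m - δ + M - α ^ 2 * M + α * b - α ^ 3 * A + g := by rw [hδ]; ring
  suffices H : δ = 0 by linear_combination H - hδ
  have hTx' := congrArg T hx'
  have hTx := congrArg T hx
  have hTδ := congrArg T hδ
  simp only [map_add, map_sub, map_mul, map_neg, map_pow, map_one, hT, hα, hb, hTA, hTB, hg]
    at hTx' hTx hTδ
  simp only [skewIm, map_one, map_sub] at im1 im0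
  have hTm : T m = M ^ 3 - T M + A ^ 2 * T M - A * (B + g * A) + A ^ 3 * α ^ 3 - (d - g)
      + (1 + A ^ 2) * δ := by
    subst hx hx' hn hY hY' hX hX'
    linear_combination (norm := (clear * - hk hε; grind)) im1 - (1 + A ^ 2) * hTM
  have hTδ' : T δ = (1 + A ^ 2) * δ := by
    linear_combination (norm := (clear * - hk hε; grind)) hTδ + hTm
  by_contra hδ0
  have E0 : δ * (δ * (1 - A ^ 2) - M + M ^ 3 - d - m - A * α ^ 3 - A ^ 3 * α ^ 3 + M * α ^ 2 - α * b) = 0 := by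
    subst hX hX' hY hY' hn
    linear_combination (norm := (rw [hTx, hTx', hTm, hTM, hx, hx']; clear * - hk hε; grind)) im0
  have E1 : M ^ 3 - T M - T g = A ^ 2 * δ - A * α ^ 3 + A ^ 3 * α ^ 3 := by
    have := (mul_eq_zero.1 E0).resolve_left hδ0
    rw [hg]
    linear_combination (norm := (clear * - hk hε; grind)) this - hTM
  have hα1 : 1 + α ^ 2 ≠ 0 := fun h0 => hneg α (by linear_combination h0)
  have hA1 : 1 + A ^ 2 ≠ 0 := fun h0 => hneg A (by linear_combination h0)
  have hTα : T (α ^ 2) = A ^ 2 := by rw [map_pow, hα]; linear_combination A ^ 2 * hε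
  obtain ⟨w, hw⟩ : ∃ w, w * (1 + α ^ 2) = δ := ⟨δ / (1 + α ^ 2), div_mul_cancel₀ _ hα1⟩
  have hTw : T w = δ := by
    refine mul_right_cancel₀ hA1 ?_
    rw [← hw, map_mul, map_add, hTα, map_one, hw] at hTδ'
    linear_combination hTδ'
  have hinj : T M - M - g = α ^ 2 * w - α * A + α ^ 3 * A := by
    apply T.injective
    simp only [map_sub, map_add, map_mul, hT, hTα, hTw, hTA, map_pow, hα]
    linear_combination E1 + (A * α ^ 3 - A ^ 3 * α ^ 3 * (ε ^ 2 + 1)) * hε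
  refine hno (M - α * A - w) ?_
  simp only [map_sub, map_mul, hTw, hTA, hα]
  linear_combination hinj + hw - A * α ^ 3 * hε

end System

section Converse

variable {k : Type*} [Field k] [hk : CharP k 3] {T : k →+* k} {ε g d : k}

theorem ReeSystem.of_generic {m n x x' y b α X X' Y Y' A B M : k}
    (hT : ∀ t, T (T t) = t ^ 3) (hε : ε ^ 2 = 1) (hTε : T ε = ε) (hg : T g = d - g)
    (hA : A = ε * T α) (hB : B = ε * T b - g * A)
    (hm : m = T M - M + α ^ 2 * M - α * b + α ^ 3 * A - g) (hy : y = M - m)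
    (hx' : x' = -α * M ^ 2 + α - b * M - B + A * (M + m - α ^ 2 * M + α * b))
    (hx : x = -α * x' + M ^ 2 + M * m + b ^ 2 + 1 + α ^ 2)
    (hn : n = α * M - b + A * (1 + α ^ 2)) (hY : Y = -n - A) (hY' : Y' = M + α * A)
    (hX : X = n * M + m * A + B) (hX' : X' = M ^ 2 + A * (α * M + b) + 1) :
    ReeSystem T ε g d m n x x' y b 1 α X X' Y Y' 0 1 := by
  have hα : T α = ε * A := by rw [hA]; linear_combination -T α * hε
  have hb : T b = ε * (B + g * A) := by rw [hB]; linear_combination -T b * hε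
  have hTA : T A = ε * α ^ 3 := by rw [hA, map_mul, hTε, hT]
  have hTB : T B = ε * b ^ 3 - (d - g) * (ε * α ^ 3) := by
    rw [hB, map_sub, map_mul, map_mul, hTε, hT, hg, hTA]
  have hTM : T M = m + M - α ^ 2 * M + α * b - α ^ 3 * A + g := by rw [hm]; ring
  have hTm := congrArg T hm
  have hTx' := congrArg T hx'
  have hTx := congrArg T hx
  simp only [map_add, map_sub, map_mul, map_neg, map_pow, map_one, hT, hα, hb, hTA, hTB, hg]
    at hTx' hTx hTm
  subst hX hX' hY hY' hn hy
  constructor <;> try simp only [skewRe, skewIm, map_one, map_sub]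
  all_goals
    try simp only [hTx, hTx', hTm, hTM, hα, hb]
    try rw [hx, hx']
    clear * - hk hε
    grind

end Converse

section Degenerate

variable {k : Type*} [Field k] {T : k →+* k} {ε g d : k}

theorem sq_add_sq_eq_zero (hneg : ∀ t : k, t ^ 2 ≠ -1) {x y : k} (h : x ^ 2 + y ^ 2 = 0) :
    x = 0 ∧ y = 0 := by
  have hy : y = 0 := by
    by_contra hy
    refine hneg (x / y) ?_
    field_simp
    linear_combination h
  subst hy
  simpa using h

theorem ReeSystem.not_imaginary [hk : CharP k 3] {m n x x' y y' X X' Y Y' ζ : k} (hε : ε ^ 2 = 1)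
    (S : ReeSystem T ε g d m n x x' y y' 0 1 X X' Y Y' ζ 0)
    (iso : x' = y ^ 2 + y' ^ 2 + 1 - m ^ 2) : False := by
  obtain ⟨re2, im2, re1, im1, re0, im0, p, p', q, q', r, r'⟩ := S
  simp only [skewRe, skewIm, map_one, map_zero] at re2 im2
  have hY' : Y' = ζ * (m - y) := by linear_combination p
  have hY : Y = ζ * y' - n := by linear_combination -p'
  have hζ : ζ * (y + m) = ε := by subst hY'; clear * - re2 hk; grind
  have hX' : X' = -x * ζ + n * y - m * Y := by linear_combination q
  have hX : X = x' * ζ + n * y' - m * Y' := by linear_combination -q'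
  have h0 : ζ = 0 := by
    subst hX hX' hY hY'
    clear * - im2 hζ iso hk
    grind
  rw [h0, zero_mul] at hζ
  rw [← hζ] at hε
  simp at hε

theorem ReeSystem.not_linear [hk : CharP k 3] {x x' y y' X X' Y Y' Z Z' : k} (hε : ε ^ 2 = 1)
    (hT : ∀ t, T (T t) = t ^ 3) (hg : T g = d - g) (hno : ∀ t, T t ≠ t + g)
    (S : ReeSystem T ε g d 1 0 x x' y y' 0 0 X X' Y Y' Z Z')
    (iso : 0 = y ^ 2 + y' ^ 2 - 1) : False := by
  obtain ⟨re2, im2, re1, im1, re0, im0, p, p', q, q', r, r'⟩ := S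
  have h3 : (3 : k) = 0 := mod_cast CharP.cast_eq_zero k 3
  have hε0 : ε ≠ 0 := by rintro rfl; simp at hε
  simp only [skewRe, skewIm, map_zero, mul_zero, zero_mul, sub_zero, add_zero, zero_sub,
    one_mul, neg_mul, neg_neg] at *
  have hZ : y * Z + y' * Z' = 0 := by linear_combination re2 + (y * Z + y' * Z') * h3
  have hZ0 : Z = 0 := by
    by_contra hZ0
    have h1 : y = -1 := by
      refine mul_right_cancel₀ hZ0 ?_
      linear_combination -p - hZ + y * Z * h3
    have h2 : y' ^ 2 = 0 := by rw [h1] at iso; linear_combination -iso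
    rw [pow_eq_zero_iff two_ne_zero] at h2
    rw [h1, h2] at hZ
    exact hZ0 (by linear_combination -hZ)
  subst hZ0
  have hY : Y = x' * Z' := by linear_combination q
  have hY' : Y' = x * Z' := by linear_combination -q'
  subst hY hY'
  by_cases hZ' : Z' = 0
  · subst hZ'
    simp only [mul_zero, zero_mul, sub_zero, add_zero, zero_sub, neg_zero, zero_add] at *
    have hy' : y' = 0 := by
      rw [← map_eq_zero T]
      refine (mul_eq_zero.1 (?_ : ε * T y' = 0)).resolve_left hε0
      linear_combination re1
    subst hy'
    have hX' : y * X' = T y := by linear_combination (norm := (simp; ring)) im1 + y * X' * h3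
    have hy0 : y ≠ 0 := by rintro rfl; simp at iso
    have hX'0 : X' ≠ 0 := by
      rintro rfl
      rw [mul_zero] at hX'
      exact hy0 ((map_eq_zero T).1 hX'.symm)
    have hy : y = 1 := mul_right_cancel₀ hX'0 (by linear_combination -r')
    subst hy
    have hX : X = 0 := by linear_combination r + X * h3
    have hX1 : X' = 1 := by simpa using hX'
    subst hX hX1
    refine hno (-x) ?_
    rw [map_neg]
    rw [map_one] at im0
    linear_combination im0 + x * h3
  · have hy' : y' = 0 := by
      have : y' * Z' = 0 := by linear_combination hZ
      exact (mul_eq_zero.1 this).resolve_right hZ'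
    subst hy'
    have hy : y = -1 := mul_right_cancel₀ hZ' (by linear_combination p')
    subst hy
    rw [map_neg, map_one] at im0 im1
    rw [map_zero] at re1
    have hx' : x' = 0 := (mul_eq_zero.1 (by linear_combination -re1 : x' * Z' = 0)).resolve_right hZ'
    subst hx'
    have hX' : X' = x ^ 2 * Z' + Z' := by linear_combination -r' + X' * h3
    subst hX'
    have hZ1 : Z' = 1 := by
      clear * - im1 hk
      grind
    subst hZ1
    refine hno x (T.injective ?_)
    rw [map_add, hT, hg]
    clear * - im0 hk
    grind

theorem ReeSystem.constant [hk : CharP k 3] {m n x x' X X' Y Y' Z Z' : k} (hneg : ∀ t : k,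
    t ^ 2 ≠ -1)
    (hε : ε ^ 2 = 1) (hx : x ≠ 0 ∨ x' ≠ 0)
    (S : ReeSystem T ε g d m n x x' 0 0 0 0 X X' Y Y' Z Z') (iso : m = 0) : x' = 0 := by
  obtain ⟨re2, im2, re1, im1, re0, im0, p, p', q, q', r, r'⟩ := S
  have h3 : (3 : k) = 0 := mod_cast CharP.cast_eq_zero k 3
  have hε0 : ε ≠ 0 := by rintro rfl; simp at hε
  subst iso
  simp only [skewRe, skewIm, map_zero, mul_zero, zero_mul, sub_zero, add_zero, zero_sub, neg_zero,
    zero_add, neg_mul] at *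
  have hxx : x ^ 2 + x' ^ 2 ≠ 0 := by
    intro h0
    obtain ⟨rfl, rfl⟩ := sq_add_sq_eq_zero hneg h0
    simp at hx
  have hZ : Z = 0 := (mul_eq_zero.1 (by linear_combination x * q + x' * q' :
    (x ^ 2 + x' ^ 2) * Z = 0)).resolve_left hxx
  have hZ' : Z' = 0 := (mul_eq_zero.1 (by linear_combination x * q' - x' * q :
    (x ^ 2 + x' ^ 2) * Z' = 0)).resolve_left hxx
  subst hZ hZ'
  simp only [mul_zero, sub_zero, add_zero] at *
  by_contra hx'
  have hY1 : x * Y' = x' * Y := by linear_combination im1 + (x * Y' - x' * Y) * h3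
  have hY : Y = -n := mul_left_cancel₀ hx' (by linear_combination -r' + hY1 + Y * x' * h3)
  subst hY
  have hY' : Y' = 0 := (mul_eq_zero.1 (by linear_combination -r : x' * Y' = 0)).resolve_left hx'
  subst hY'
  have hn : n = 0 := (mul_eq_zero.1 (by linear_combination hY1 : x' * n = 0)).resolve_left hx'
  subst hn
  have : ε * T x' = 0 := by linear_combination re0
  exact hx' ((map_eq_zero T).1 ((mul_eq_zero.1 this).resolve_left hε0))

end Degenerate

section Frame

variable {F : Type*} [Field F] {σ τ : F →+* F} {i e : F} {ε g d : fixedSubfield σ}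

theorem isReeVector_iff {l : F} :
    IsReeVector σ τ i l ↔ l ≠ 0 ∧ ∃ (μ : F) (m n : fixedSubfield σ), IsReeDatum σ τ i l μ m n := by
  refine and_congr_right fun _ => exists_congr fun μ => ⟨?_, ?_⟩
  · rintro ⟨m, n, hm, hn, h1, h2⟩
    exact ⟨⟨m, hm⟩, ⟨n, hn⟩, hm, hn, h1, h2⟩
  · rintro ⟨m, n, hm, hn, h1, h2⟩
    exact ⟨m, n, hm, hn, h1, h2⟩

theorem IsReeDatum.exists_smul (h : IsReePair σ τ) {l μ : F}
    {m n c : fixedSubfield σ} (D : IsReeDatum σ τ i l μ m n) (hc : c ≠ 0) :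
    ∃ (μ' : F) (n' : fixedSubfield σ),
      IsReeDatum σ τ i (c * l) μ' ((c * m : fixedSubfield σ) : F) n' := by
  have hc' : (c : F) ≠ 0 := mod_cast hc
  exact ⟨_, h.fixedTau c / c * n, by exact_mod_cast D.smul h (map_coe_fixedSubfield c) hc'⟩

/-- The slope of the Ree vector with parameters `α`, `b`, `M`. -/
def genericSlope (T : fixedSubfield σ →+* fixedSubfield σ) (ε g α b M : fixedSubfield σ) :
    fixedSubfield σ :=
  T M - M + α ^ 2 * M - α * b + α ^ 3 * (ε * T α) - g

/-- The real part of the constant coordinate of the Ree vector with parameters `α`, `b`, `M`. -/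
def genericIm (T : fixedSubfield σ →+* fixedSubfield σ) (ε g α b M : fixedSubfield σ) :
    fixedSubfield σ :=
  -α * M ^ 2 + α - b * M - (ε * T b - g * (ε * T α))
    + ε * T α * (M + genericSlope T ε g α b M - α ^ 2 * M + α * b)

/-- The Ree vector with parameters `α`, `b`, `M`. -/
def genericVec (i e : F) (T : fixedSubfield σ →+* fixedSubfield σ) (ε g α b M : fixedSubfield σ) : F :=
  reeVec i e (-α * genericIm T ε g α b M + M ^ 2 + M * genericSlope T ε g α b M + b ^ 2 + 1 + α ^ 2)
    (genericIm T ε g α b M) (M - genericSlope T ε g α b M) b 1 α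

namespace IsReeFrame


theorem i_ne_zero (f : IsReeFrame σ τ i e ε g d) : i ≠ 0 := by
  rintro rfl
  simpa using f.i_sq

theorem sq_ne_neg_one [CharP F 3] (f : IsReeFrame σ τ i e ε g d)
    (t : fixedSubfield σ) : t ^ 2 ≠ -1 := by
  intro h
  have h1 : (t : F) ^ 2 = -1 := mod_cast congrArg ((↑) : fixedSubfield σ → F) h
  have h2 : ((t : F) - i) * (t + i) = 0 := by linear_combination h1 - f.i_sq
  have h3 : (2 : F) * i = 0 := by
    rcases mul_eq_zero.1 h2 with h | h
    · have h' := congrArg σ h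
      simp only [map_sub, map_coe_fixedSubfield, f.sigma_i, map_zero] at h'
      linear_combination h' - h
    · have h' := congrArg σ h
      simp only [map_add, map_coe_fixedSubfield, f.sigma_i, map_zero] at h'
      linear_combination h - h'
  exact mul_ne_zero two_ne f.i_ne_zero h3

theorem fixedTau_eps (f : IsReeFrame σ τ i e ε g d) (h : IsReePair σ τ) : h.fixedTau ε = ε := by
  have h2 : (ε - 1) * (ε + 1) = 0 := by linear_combination f.eps_sq
  rcases mul_eq_zero.1 h2 with h | h
  · rw [sub_eq_zero.1 h, map_one]
  · rw [eq_neg_of_add_eq_zero_left h, map_neg, map_one]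

theorem fixedTau_g [CharP F 3] (f : IsReeFrame σ τ i e ε g d)
    (h : IsReePair σ τ) : h.fixedTau g = d - g := by
  have h3 : (3 : F) = 0 := mod_cast CharP.cast_eq_zero F 3
  apply Subtype.ext
  have h1 := h.sq e
  rw [f.tau_e, map_add, f.tau_e, map_sub, map_one, f.sigma_e] at h1
  push_cast
  rw [h.coe_fixedTau]
  linear_combination h1 + f.cube_e + (e ^ 2 + e + 1) * h3

theorem fixedTau_ne_add [CharP F 3] (f : IsReeFrame σ τ i e ε g d) (h : IsReePair σ τ)
    (t : fixedSubfield σ) :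
    h.fixedTau t ≠ t + g := by
  have h3 : (3 : F) = 0 := mod_cast CharP.cast_eq_zero F 3
  intro ht
  have ht' : τ (t : F) = t + g := congrArg ((↑) : fixedSubfield σ → F) ht
  have h1 : τ (e - t) = (e - t) - 1 := by
    rw [map_sub, f.tau_e, ht']; ring
  have h2 := h.sq (e - t)
  rw [h1, map_sub, h1, map_one, map_sub, f.sigma_e, map_coe_fixedSubfield] at h2
  have h4 : (e - t) * (e - t - 1) * (e - t + 1) = 0 := by
    linear_combination -h2 - (1 + (e - t) ^ 2 + (e - t)) * h3
  have h5 : σ (e - t) = e - t := by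
    rcases mul_eq_zero.1 h4 with h4 | h4
    · rcases mul_eq_zero.1 h4 with h4 | h4
      · rw [h4, map_zero]
      · rw [sub_eq_zero.1 h4, map_one]
    · rw [eq_neg_of_add_eq_zero_left h4, map_neg, map_one]
  rw [map_sub, f.sigma_e, map_coe_fixedSubfield] at h5
  exact one_ne_zero (α := F) (by linear_combination h5)

theorem datum_constant [CharP F 3] (f : IsReeFrame σ τ i e ε g d)
    (h : IsReePair σ τ) {c : fixedSubfield σ}
    (hc : c ≠ 0) : IsReeDatum σ τ i (c : F) (i * τ c / c) 0 0 := by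
  have h3 : (3 : F) = 0 := mod_cast CharP.cast_eq_zero F 3
  have hc' : (c : F) ≠ 0 := mod_cast hc
  have ht : σ (τ (c : F)) = τ c := by rw [← h.comm, map_coe_fixedSubfield]
  constructor
  · exact map_zero σ
  · exact map_zero σ
  · simp only [map_div₀, map_mul, f.sigma_i, ht, map_coe_fixedSubfield]
    field_simp
    linear_combination -(i * τ (c : F)) * h3
  · simp only [map_div₀, map_mul, map_neg, f.sigma_i, ht, map_coe_fixedSubfield]
    ring

theorem datum_generic [CharP F 3] (f : IsReeFrame σ τ i e ε g d) (h : IsReePair σ τ)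
    (α b M : fixedSubfield σ) :
    ∃ (μ : F) (n : fixedSubfield σ), IsReeDatum σ τ i (genericVec i e h.fixedTau ε g α b M) μ
      (genericSlope h.fixedTau ε g α b M) n := by
  obtain ⟨h1, h2⟩ := (f.system_iff h _ _ _ _ _ _ _ _ _ _ _ _ _ _).2
    (ReeSystem.of_generic (α := α) (b := b) (M := M) h.fixedTau_fixedTau f.eps_sq (f.fixedTau_eps h)
    (f.fixedTau_g h) rfl rfl (m := genericSlope h.fixedTau ε g α b M) rfl rfl
    (x' := genericIm h.fixedTau ε g α b M) rfl rfl rfl rfl rfl rfl rfl)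
  exact ⟨_, _, map_coe_fixedSubfield _, map_coe_fixedSubfield _, h1, h2⟩

theorem system [CharP F 3] (f : IsReeFrame σ τ i e ε g d) (h : IsReePair σ τ)
    {m n x x' y y' z z' X X' Y Y' Z Z' : fixedSubfield σ}
    (D : IsReeDatum σ τ i (reeVec i e x x' y y' z z') (reeVec i e X X' Y Y' Z Z') m n) :
    ReeSystem h.fixedTau ε g d m n x x' y y' z z' X X' Y Y' Z Z' :=
  (f.system_iff h m n x x' y y' z z' X X' Y Y' Z Z').1 ⟨D.first, D.second⟩

theorem eq_genericVec [CharP F 3] (f : IsReeFrame σ τ i e ε g d) (h : IsReePair σ τ)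
    {x x' y b α m n : fixedSubfield σ} {μ : F}
    (D : IsReeDatum σ τ i (reeVec i e x x' y b 1 α) μ m n) :
    reeVec i e x x' y b 1 α = genericVec i e h.fixedTau ε g α b (y + m) := by
  have hl : reeVec i e x x' y b 1 α ≠ 0 := fun h0 => one_ne_zero (f.vec_eq_zero h0).2.2.2.2.1
  have iso := f.isotropic h hl D
  obtain ⟨X, X', Y, Y', Z, Z', rfl⟩ := f.exists_vec h μ
  have D1 := D.shift (map_coe_fixedSubfield (-Z))
  rw [vec_smul, reeVec_add, mul_one, add_neg_cancel] at D1
  have S := f.system h (n := n + m * -Z) (by exact_mod_cast D1)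
  have hm := S.generic f.sq_ne_neg_one h.fixedTau_fixedTau f.eps_sq (f.fixedTau_eps h)
    (f.fixedTau_g h) (f.fixedTau_ne_add h) rfl rfl (by linear_combination iso)
  obtain ⟨-, -, -, -, -, -, hx', hx⟩ := S.generic_linear f.sq_ne_neg_one f.eps_sq rfl rfl
    (by linear_combination iso)
  have hm' : genericSlope h.fixedTau ε g α b (y + m) = m := hm.symm
  have hx1 : genericIm h.fixedTau ε g α b (y + m) = x' := by
    rw [genericIm, hm', hx']
    have h3 : (3 : fixedSubfield σ) = 0 := mod_cast CharP.cast_eq_zero _ 3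
    linear_combination (ε * h.fixedTau α * m) * h3
  rw [genericVec, hm', hx1, add_sub_cancel_right, hx]

theorem not_imaginary [CharP F 3] (f : IsReeFrame σ τ i e ε g d) (h : IsReePair σ τ)
    {x x' y y' m n : fixedSubfield σ} {μ : F}
    (D : IsReeDatum σ τ i (reeVec i e x x' y y' 0 1) μ m n) : False := by
  have hl : reeVec i e x x' y y' 0 1 ≠ 0 := fun h0 => one_ne_zero (f.vec_eq_zero h0).2.2.2.2.2
  have iso := f.isotropic h hl D
  obtain ⟨X, X', Y, Y', Z, Z', rfl⟩ := f.exists_vec h μ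
  have D1 := D.shift (map_coe_fixedSubfield (-Z'))
  rw [vec_smul, reeVec_add, mul_one, add_neg_cancel, mul_zero, add_zero] at D1
  exact (f.system h (n := n + m * -Z') (by exact_mod_cast D1)).not_imaginary f.eps_sq
    (by linear_combination iso)

theorem not_linear [CharP F 3] (f : IsReeFrame σ τ i e ε g d) (h : IsReePair σ τ)
    {x x' y y' n : fixedSubfield σ} {μ : F} (hl : reeVec i e x x' y y' 0 0 ≠ 0)
    (D : IsReeDatum σ τ i (reeVec i e x x' y y' 0 0) μ (1 : fixedSubfield σ) n) : False := by
  have iso := f.isotropic h hl D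
  have D1 := D.shift (map_coe_fixedSubfield (-n))
  obtain ⟨X, X', Y, Y', Z, Z', hμ⟩ :=
    f.exists_vec h (μ + (-n : fixedSubfield σ) * reeVec i e x x' y y' 0 0)
  have hn : (n : F) + (1 : fixedSubfield σ) * (-n : fixedSubfield σ) = (0 : fixedSubfield σ) := by
    push_cast; ring
  rw [hμ, hn] at D1
  exact (f.system h D1).not_linear f.eps_sq h.fixedTau_fixedTau (f.fixedTau_g h)
    (f.fixedTau_ne_add h) (by linear_combination iso)

theorem classification [CharP F 3] (f : IsReeFrame σ τ i e ε g d) (h : IsReePair σ τ) {l : F}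
    (hl : IsReeVector σ τ i l) : ∃ c : fixedSubfield σ, c ≠ 0 ∧
      (l = c ∨ ∃ α b M, l = c * genericVec i e h.fixedTau ε g α b M) := by
  obtain ⟨hl0, μ, m, n, D⟩ := isReeVector_iff.1 hl
  obtain ⟨x, x', y, y', z, z', rfl⟩ := f.exists_vec h l
  by_cases hz : z = 0
  · subst hz
    by_cases hz' : z' = 0
    · subst hz'
      by_cases hm : m = 0
      · subst hm
        have iso := f.isotropic h hl0 D
        obtain ⟨rfl, rfl⟩ := sq_add_sq_eq_zero f.sq_ne_neg_one
          (by linear_combination -iso : y ^ 2 + y' ^ 2 = 0)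
        have hx : x ≠ 0 ∨ x' ≠ 0 := by
          by_contra! hx
          exact hl0 (by simp [reeVec, hx])
        obtain ⟨X, X', Y, Y', Z, Z', rfl⟩ := f.exists_vec h μ
        obtain rfl := (f.system h D).constant f.sq_ne_neg_one f.eps_sq hx rfl
        exact ⟨x, hx.resolve_right (not_not.2 rfl), Or.inl (by simp [reeVec])⟩
      · obtain ⟨μ', n', D1⟩ := D.exists_smul h (inv_ne_zero hm)
        have hl1 := mul_ne_zero (a := ((m⁻¹ : fixedSubfield σ) : F))
          (by exact_mod_cast inv_ne_zero hm) hl0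
        rw [vec_smul, mul_zero] at D1 hl1
        rw [inv_mul_cancel₀ hm] at D1
        exact (f.not_linear h hl1 D1).elim
    · obtain ⟨μ', n', D1⟩ := D.exists_smul h (inv_ne_zero hz')
      rw [vec_smul, mul_zero, inv_mul_cancel₀ hz'] at D1
      exact (f.not_imaginary h D1).elim
  · obtain ⟨μ', n', D1⟩ := D.exists_smul h (inv_ne_zero hz)
    have hz' : (z : F) ≠ 0 := mod_cast hz
    rw [vec_smul, inv_mul_cancel₀ hz] at D1
    refine ⟨z, hz, Or.inr ⟨z⁻¹ * z', z⁻¹ * y', z⁻¹ * y + z⁻¹ * m, ?_⟩⟩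
    rw [← f.eq_genericVec h D1, vec_smul]
    simp only [mul_inv_cancel_left₀ hz, mul_one]

theorem isReeVector_smul_generic [CharP F 3] (f : IsReeFrame σ τ i e ε g d) (h : IsReePair σ τ)
    {c : fixedSubfield σ} (hc : c ≠ 0) (α b M : fixedSubfield σ) :
    IsReeVector σ τ i (c * genericVec i e h.fixedTau ε g α b M) := by
  obtain ⟨μ, n, D⟩ := f.datum_generic h α b M
  obtain ⟨μ', n', D'⟩ := D.exists_smul h hc
  exact isReeVector_iff.2 ⟨mul_ne_zero (mod_cast hc) fun h0 =>
    one_ne_zero (f.vec_eq_zero h0).2.2.2.2.1, _, _, _, D'⟩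

theorem genericVec_injective [CharP F 3] (f : IsReeFrame σ τ i e ε g d) (h : IsReePair σ τ)
    {α b M α' b' M' : fixedSubfield σ}
    (H : genericVec i e h.fixedTau ε g α b M = genericVec i e h.fixedTau ε g α' b' M') :
    α = α' ∧ b = b' ∧ M = M' := by
  obtain ⟨μ, n, D⟩ := f.datum_generic h α b M
  obtain ⟨μ', n', D'⟩ := f.datum_generic h α' b' M'
  have hl : genericVec i e h.fixedTau ε g α b M ≠ 0 := fun h0 =>
    one_ne_zero (f.vec_eq_zero h0).2.2.2.2.1
  rw [← H] at D'
  have hm := Subtype.ext (D.unique D' f.i_ne_zero hl)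
  obtain ⟨-, -, hy, hb, -, hα⟩ := f.vec_inj.1 H
  refine ⟨hα, hb, ?_⟩
  linear_combination hy + hm

theorem card_isReeVector [CharP F 3] (f : IsReeFrame σ τ i e ε g d) (h : IsReePair σ τ)
    [Finite (fixedSubfield σ)] :
    Nat.card {l // IsReeVector σ τ i l} =
      (Nat.card (fixedSubfield σ) - 1) * (Nat.card (fixedSubfield σ) ^ 3 + 1) := by
  let k := fixedSubfield σ
  let Φ : kˣ × Option (k × k × k) → {l // IsReeVector σ τ i l} := fun p =>
    match p with
    | (c, none) => ⟨((c : k) : F), isReeVector_iff.2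
        ⟨by exact_mod_cast c.ne_zero, _, 0, 0, f.datum_constant h c.ne_zero⟩⟩
    | (c, some (α, b, M)) => ⟨_, f.isReeVector_smul_generic h c.ne_zero α b M⟩
  have hconst (c : k) : (c : F) = reeVec i e c 0 0 0 0 0 := by simp [reeVec]
  have hΦ : Function.Bijective Φ := by
    constructor
    · rintro ⟨c, _ | ⟨α, b, M⟩⟩ ⟨c', _ | ⟨α', b', M'⟩⟩ H
      · have := congrArg Subtype.val H
        simpa [Φ, Units.ext_iff] using this
      · have := congrArg Subtype.val H
        simp only [Φ, hconst (c : k), genericVec, vec_smul, f.vec_inj, mul_one] at this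
        exact (c'.ne_zero this.2.2.2.2.1.symm).elim
      · have := congrArg Subtype.val H
        simp only [Φ, hconst (c' : k), genericVec, vec_smul, f.vec_inj, mul_one] at this
        exact (c.ne_zero this.2.2.2.2.1).elim
      · have H1 := congrArg Subtype.val H
        have H2 := H1
        simp only [Φ, genericVec, vec_smul, f.vec_inj, mul_one] at H2
        obtain rfl : c = c' := Units.ext H2.2.2.2.2.1
        have hc : ((c : k) : F) ≠ 0 := by exact_mod_cast c.ne_zero
        obtain ⟨rfl, rfl, rfl⟩ := f.genericVec_injective h (mul_left_cancel₀ hc H1)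
        rfl
    · rintro ⟨l, hl⟩
      obtain ⟨c, hc, rfl | ⟨α, b, M, rfl⟩⟩ := f.classification h hl
      · exact ⟨(Units.mk0 c hc, none), rfl⟩
      · exact ⟨(Units.mk0 c hc, some (α, b, M)), rfl⟩
  rw [← Nat.card_congr (Equiv.ofBijective Φ hΦ), Nat.card_prod, Finite.card_option, Nat.card_prod,
    Nat.card_prod, Nat.card_units]
  ring

end IsReeFrame

end Frame

section Fibers

variable {F : Type*} [Field F] {σ τ : F →+* F}

theorem card_sub_fiber {u : F} (hu : ∃ x, σ x - x = u) :
    Nat.card {x // σ x - x = u} = Nat.card (fixedSubfield σ) := by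
  obtain ⟨x₀, rfl⟩ := hu
  refine Nat.card_congr
    { toFun := fun x => ⟨x - x₀, ?_⟩
      invFun := fun c => ⟨x₀ + c, ?_⟩
      left_inv := fun x => ?_
      right_inv := fun c => ?_ }
  · rw [mem_fixedSubfield, map_sub]; linear_combination x.2
  · rw [map_add, map_coe_fixedSubfield]; ring
  · simp
  · simp

variable {i e : F} {ε g d : fixedSubfield σ}

theorem IsReeFrame.card_eq [CharP F 3] (f : IsReeFrame σ τ i e ε g d) (h : IsReePair σ τ) :
    Nat.card F = Nat.card (fixedSubfield σ) ^ 6 := by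
  let k := fixedSubfield σ
  let Φ : k × k × k × k × k × k → F := fun p =>
    reeVec i e p.1 p.2.1 p.2.2.1 p.2.2.2.1 p.2.2.2.2.1 p.2.2.2.2.2
  have hΦ : Function.Bijective Φ := by
    constructor
    · rintro ⟨x, x', y, y', z, z'⟩ ⟨X, X', Y, Y', Z, Z'⟩ H
      obtain ⟨rfl, rfl, rfl, rfl, rfl, rfl⟩ := f.vec_inj.1 H
      rfl
    · intro l
      obtain ⟨x, x', y, y', z, z', rfl⟩ := f.exists_vec h l
      exact ⟨(x, x', y, y', z, z'), rfl⟩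
  rw [← Nat.card_congr (Equiv.ofBijective Φ hΦ)]
  simp only [Nat.card_prod]
  ring

theorem IsReeFrame.exists_sub_eq_iff [CharP F 3] (f : IsReeFrame σ τ i e ε g d)
    (h : IsReePair σ τ) {u : F} :
    (∃ x, σ x - x = u) ↔ cyclicTrace σ u = 0 := by
  have h3 : (3 : fixedSubfield σ) = 0 := mod_cast CharP.cast_eq_zero _ 3
  constructor
  · rintro ⟨x, rfl⟩
    simp only [cyclicTrace, map_sub, h.six]
    ring
  · intro hu
    obtain ⟨x, x', y, y', z, z', rfl⟩ := f.exists_vec h u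
    have hz : z = 0 := by
      have hz := hu
      simp only [cyclicTrace, f.map_vec, reeVec_add] at hz
      have hz1 := (f.vec_eq_zero hz).1
      linear_combination hz1 - (2 * x - 2 * z + 5 * y) * h3
    subst hz
    refine ⟨reeVec i e 0 (x' + y') (x + y) (y' - z') (-y) z', ?_⟩
    rw [f.map_vec, IsReeFrame.vec_sub, f.vec_inj]
    refine ⟨by ring, ?_, by ring, ?_, by ring, ?_⟩
    · linear_combination -(x' + y') * h3
    · linear_combination (z' - y') * h3
    · linear_combination -z' * h3

theorem IsAbscissa.add_fixed {a c : F} (h : IsReePair σ τ) (hA : IsAbscissa σ τ a) (hc : σ c = c) :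
    IsAbscissa σ τ (a + c) := by
  obtain ⟨h1, h2⟩ := hA
  simp only [IsAbscissa, cyclicTrace, map_sub, map_add, map_mul, map_pow, hc, h.comm, h.six] at h1 h2 ⊢
  constructor
  · linear_combination h1
  · linear_combination h2 + 2 * c * h1

end Fibers

theorem card_prod_eq_mul {α β : Type*} [Finite α] [Finite β] {R : α → β → Prop} {P : α → Prop} {n : ℕ}
    (hP : ∀ a b, R a b → P a) (hn : ∀ a, P a → Nat.card {b // R a b} = n) :
    Nat.card {p : α × β // R p.1 p.2} = Nat.card {a // P a} * n := by
  classical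
  have := Fintype.ofFinite {a // P a}
  let Φ : {p : α × β // R p.1 p.2} ≃ Σ a : {a // P a}, {b // R a b} :=
    { toFun := fun p => ⟨⟨p.1.1, hP _ _ p.2⟩, ⟨p.1.2, p.2⟩⟩
      invFun := fun p => ⟨(p.1, p.2), p.2.2⟩
      left_inv := fun _ => rfl
      right_inv := fun _ => rfl }
  rw [Nat.card_congr Φ, Nat.card_sigma, Finset.sum_congr rfl fun (a : {a // P a}) _ => hn a.1 a.2]
  simp [Nat.card_eq_fintype_card]

theorem card_pow_eq {G : Type*} [CommGroup G] [IsCyclic G] [Finite G] {r m : ℕ}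
    (hG : Nat.card G = r * m) {v : G} (hv : v ^ m = 1) : Nat.card {l : G // l ^ r = v} = r := by
  have hpos : 0 < r * m := hG ▸ Nat.card_pos
  have hr : 0 < r := Nat.pos_of_mul_pos_right hpos
  have hle : (powMonoidHom r : G →* G).range ≤ (powMonoidHom m : G →* G).ker := by
    rintro _ ⟨l, rfl⟩
    rw [MonoidHom.mem_ker, powMonoidHom_apply, powMonoidHom_apply, ← pow_mul, ← hG, pow_card_eq_one']
  have heq := Subgroup.eq_of_le_of_card_ge hle (by
    rw [IsCyclic.card_powMonoidHom_ker, IsCyclic.card_powMonoidHom_range, hG,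
      Nat.gcd_mul_left_left, Nat.gcd_mul_right_left, Nat.mul_div_cancel_left _ hr])
  obtain ⟨l₀, rfl⟩ : v ∈ (powMonoidHom r : G →* G).range := heq ▸ MonoidHom.mem_ker.2 hv
  have hker := IsCyclic.card_powMonoidHom_ker (G := G) r
  rw [hG, Nat.gcd_mul_right_left] at hker
  refine (Nat.card_congr (α := {l : G // l ^ r = powMonoidHom r l₀}) (β := (powMonoidHom r : G →* G).ker)
    { toFun := fun l => ⟨l / l₀, ?_⟩
      invFun := fun c => ⟨c * l₀, ?_⟩
      left_inv := fun l => ?_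
      right_inv := fun c => ?_ }).trans hker
  · have : (l : G) ^ r = l₀ ^ r := l.2
    rw [MonoidHom.mem_ker, powMonoidHom_apply, div_pow, this, div_self']
  · have : (c : G) ^ r = 1 := MonoidHom.mem_ker.1 c.2
    rw [powMonoidHom_apply]
    rw [mul_pow, this, one_mul]
  · simp
  · simp

section Count

variable {F : Type*} [Field F] {σ τ : F →+* F} {i e : F} {ε g d : fixedSubfield σ}

theorem IsReeFrame.card_scaled_fiber [CharP F 3] (f : IsReeFrame σ τ i e ε g d)
    (h : IsReePair σ τ) {l : F}
    (hl : IsReeVector σ τ i l) :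
    Nat.card {a // l ≠ 0 ∧ IsAbscissa σ τ a ∧ (σ a - a) * (l * σ l) = i * τ l} =
      Nat.card (fixedSubfield σ) := by
  obtain ⟨a₀, hA, ht⟩ := hl.exists_abscissa h f.isImaginaryUnit
  have hl0 := hl.1
  have hl1 : l * σ l ≠ 0 := mul_ne_zero hl0 (by simpa using hl0)
  rw [← card_sub_fiber (u := σ a₀ - a₀) ⟨a₀, rfl⟩]
  refine Nat.card_congr (Equiv.subtypeEquivRight fun a => ⟨fun ha => ?_, fun ha => ?_⟩)
  · exact mul_right_cancel₀ hl1 (ha.2.2.trans ht.symm)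
  · refine ⟨hl0, ?_, by rw [ha, ht]⟩
    have hc : σ (a - a₀) = a - a₀ := by rw [map_sub]; linear_combination ha
    simpa using hA.add_fixed h hc

theorem pow_kappa {q p : ℕ} (hσ : ∀ x, σ x = x ^ q) (hτ : ∀ x, τ x = x ^ p) (t : F) :
    kappa σ τ t = t ^ ((q + 1) * (q + 1 + p)) := by
  simp only [kappa, hσ, hτ]
  ring

theorem IsReeFrame.kappa_i [CharP F 3] (f : IsReeFrame σ τ i e ε g d) : kappa σ τ i = 1 := by
  have h1 := f.isImaginaryUnit.tau
  have h2 := f.isImaginaryUnit.tau_sq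
  have h3 := f.i_sq
  simp only [kappa, f.sigma_i, map_neg, h1]
  linear_combination (-i ^ 4) * h2 + (i ^ 2 - 1) * h3

theorem IsReeFrame.card_scale [CharP F 3] [Finite F] (f : IsReeFrame σ τ i e ε g d)
    (h : IsReePair σ τ)
    {q p r : ℕ} (hσ : ∀ x, σ x = x ^ q) (hτ : ∀ x, τ x = x ^ p) (hr : r + p = q + 1)
    (hp : p ^ 2 = 3 * q) (hF : Nat.card F = q ^ 6) {a : F} (hA : IsAbscissa σ τ a)
    (ha : σ a ≠ a) :
    Nat.card {l // l ≠ 0 ∧ IsAbscissa σ τ a ∧ (σ a - a) * (l * σ l) = i * τ l} = r := by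
  obtain ⟨v, hv⟩ : ∃ v : Fˣ, (v : F) = i / (σ a - a) :=
    ⟨Units.mk0 _ (div_ne_zero f.i_ne_zero (sub_ne_zero.2 ha)), rfl⟩
  have hq : 0 < q := by
    rcases Nat.eq_zero_or_pos q with rfl | hq
    · exact absurd hF (by simpa using Nat.card_pos.ne')
    · exact hq
  have hq1 : 1 ≤ q ^ 3 := Nat.one_le_pow _ _ hq
  have hG : Nat.card Fˣ = r * ((q + 1) * (q + 1 + p) * (q ^ 3 - 1)) := by
    rw [Nat.card_units, hF]
    have hq6 : 1 ≤ q ^ 6 := Nat.one_le_pow _ _ hq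
    zify [hq1, hq6] at hr hp ⊢
    rw [show (r : ℤ) = q + 1 - p by linarith]
    linear_combination (q + 1 : ℤ) * (q ^ 3 - 1) * hp
  have hvm : v ^ ((q + 1) * (q + 1 + p) * (q ^ 3 - 1)) = 1 := by
    have hk := kappa_invariant h ha hA
    set t := σ a - a
    have ht : t ≠ 0 := sub_ne_zero.2 ha
    have hkv : (v : F) ^ ((q + 1) * (q + 1 + p)) = (kappa σ τ t)⁻¹ := by
      rw [hv, div_pow, ← pow_kappa hσ hτ, ← pow_kappa hσ hτ, f.kappa_i, one_div]
    have hk0 : kappa σ τ t ≠ 0 := by rw [pow_kappa hσ hτ]; exact pow_ne_zero _ ht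
    have hk1 : kappa σ τ t ^ (q ^ 3 - 1) = 1 := by
      apply mul_right_cancel₀ hk0
      rw [← pow_succ, Nat.sub_add_cancel hq1, one_mul]
      simp only [hσ, ← pow_mul] at hk
      rwa [pow_succ, pow_two]
    ext
    rw [Units.val_pow_eq_pow_val, pow_mul, hkv, inv_pow, hk1, inv_one, Units.val_one]
  rw [← card_pow_eq hG hvm]
  have key : ∀ l : Fˣ, l ^ r = v ↔ (σ a - a) * (l * σ l) = i * τ l := by
    intro l
    have hlp : (l : F) ^ p ≠ 0 := pow_ne_zero _ l.ne_zero
    rw [Units.ext_iff, Units.val_pow_eq_pow_val, hv, eq_div_iff (sub_ne_zero.2 ha), hσ l, hτ l,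
      ← mul_left_inj' hlp, ← pow_succ', ← hr, pow_add]
    constructor <;> intro H <;> linear_combination H
  refine Nat.card_congr
    { toFun := fun l => ⟨Units.mk0 l.1 l.2.1, (key _).2 l.2.2.2⟩
      invFun := fun l => ⟨l.1, l.1.ne_zero, hA, (key _).1 l.2⟩
      left_inv := fun l => rfl
      right_inv := fun l => by ext; rfl }

theorem IsReeFrame.card_isAbscissa_ne [CharP F 3] [Finite F] (f : IsReeFrame σ τ i e ε g d)
    (h : IsReePair σ τ) {q p r : ℕ} (hσ : ∀ x, σ x = x ^ q) (hτ : ∀ x, τ x = x ^ p)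
    (hr : r + p = q + 1) (hp : p ^ 2 = 3 * q) (hF : Nat.card F = q ^ 6)
    (hk : Nat.card (fixedSubfield σ) = q) :
    Nat.card {a // IsAbscissa σ τ a ∧ σ a ≠ a} * r = (q - 1) * (q ^ 3 + 1) * q := by
  let R : F → F → Prop := fun l a => l ≠ 0 ∧ IsAbscissa σ τ a ∧ (σ a - a) * (l * σ l) = i * τ l
  have H1 : Nat.card {x : F × F // R x.1 x.2} = (q - 1) * (q ^ 3 + 1) * q := by
    rw [card_prod_eq_mul (R := R) (P := IsReeVector σ τ i) (n := q)
      (fun l a H => isReeVector_of_isAbscissa h f.isImaginaryUnit H.1 H.2.1 H.2.2)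
      (fun l hl => (f.card_scaled_fiber h hl).trans hk), f.card_isReeVector h, hk]
  rw [← H1, ← card_prod_eq_mul (R := fun a l => R l a)]
  · exact Nat.card_congr ((Equiv.prodComm F F).subtypeEquiv fun _ => Iff.rfl)
  · refine fun a l H => ⟨H.2.1, fun h0 => ?_⟩
    have := H.2.2
    rw [h0, sub_self, zero_mul, eq_comm] at this
    exact mul_ne_zero f.i_ne_zero ((map_ne_zero τ).2 H.1) this
  · exact fun a H => f.card_scale h hσ hτ hr hp hF H.1 H.2

theorem IsReeFrame.card_isAbscissa [CharP F 3] [Finite F] (f : IsReeFrame σ τ i e ε g d)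
    (h : IsReePair σ τ) {q p : ℕ} (hσ : ∀ x, σ x = x ^ q) (hτ : ∀ x, τ x = x ^ p)
    (hpq : p ≤ q) (hp : p ^ 2 = 3 * q) (hF : Nat.card F = q ^ 6)
    (hk : Nat.card (fixedSubfield σ) = q) :
    Nat.card {a // IsAbscissa σ τ a} = q + q * (q - 1) * (q + 1) * (q + 1 + p) := by
  classical
  have hne := f.card_isAbscissa_ne h hσ hτ (r := q + 1 - p) (by omega) hp hF hk
  have hmul : (q ^ 3 + 1) = (q + 1) * (q + 1 + p) * (q + 1 - p) := by
    zify [show p ≤ q + 1 by omega] at hp ⊢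
    linear_combination (q + 1 : ℤ) * hp
  have hne' : Nat.card {a // IsAbscissa σ τ a ∧ σ a ≠ a} = q * (q - 1) * (q + 1) * (q + 1 + p) := by
    apply Nat.eq_of_mul_eq_mul_right (show 0 < q + 1 - p by omega)
    rw [hne, hmul]
    ring
  have hfix : Nat.card {a // IsAbscissa σ τ a ∧ σ a = a} = q := by
    rw [← hk]
    refine Nat.card_congr (Equiv.subtypeEquivRight fun a => ⟨fun H => H.2, fun H => ?_⟩)
    rw [mem_fixedSubfield] at H
    exact ⟨isAbscissa_of_sq_fixed h (by rw [H, H]), H⟩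
  have hfix' := hfix
  have := Fintype.ofFinite F
  simp only [Nat.card_eq_fintype_card, Fintype.card_subtype] at hne' hfix ⊢
  rw [← Finset.card_filter_add_card_filter_not (p := fun a => σ a = a), Finset.filter_filter,
    Finset.filter_filter, hfix, hne']

end Count

section Existence

variable {F : Type*} [Field F] {σ τ : F →+* F}

theorem cyclicTrace_map (h : IsReePair σ τ) (u : F) : σ (cyclicTrace σ u) = cyclicTrace σ u := by
  simp only [cyclicTrace, map_add, h.six]
  ring

theorem map_cyclicTrace (h : IsReePair σ τ) (u : F) :
    τ (cyclicTrace σ u) = cyclicTrace σ (τ u) := by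
  simp only [cyclicTrace, map_add, h.comm]

variable [CharP F 3]

theorem IsReePair.exists_sub_eq_one (h : IsReePair σ τ) (hu : ∃ u, cyclicTrace σ u ≠ 0) :
    ∃ e, σ e = e + 1 := by
  obtain ⟨u, hu⟩ := hu
  have h3 : (3 : F) = 0 := mod_cast CharP.cast_eq_zero F 3
  have hT := cyclicTrace_map h u
  refine ⟨-(σ u + 2 * σ (σ u) + 3 * σ (σ (σ u)) + 4 * σ (σ (σ (σ u))) +
    5 * σ (σ (σ (σ (σ u))))) / cyclicTrace σ u, ?_⟩
  rw [map_div₀, hT, div_add_one hu]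
  congr 1
  simp only [map_neg, map_add, map_mul, map_ofNat, h.six, cyclicTrace]
  linear_combination (-2 * u) * h3

theorem IsReePair.exists_frame (h : IsReePair σ τ) (hu : ∃ u, cyclicTrace σ u ≠ 0) {i ε : F}
    (hi : i ^ 2 = -1) (hσ : σ i = -i) (hτ : τ i = ε * i) (hε : σ ε = ε) (hε2 : ε ^ 2 = 1) :
    ∃ (e : F) (ε g d : fixedSubfield σ), IsReeFrame σ τ i e ε g d := by
  obtain ⟨e, he⟩ := h.exists_sub_eq_one hu
  refine ⟨e, ⟨ε, hε⟩, ⟨τ e - e + 1, ?_⟩, ⟨e ^ 3 - e, ?_⟩, ?_⟩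
  · rw [mem_fixedSubfield, map_add, map_sub, ← h.comm, he, map_add, map_one, map_one]; ring
  · rw [mem_fixedSubfield, map_sub, map_pow, he, cube_add_char_three]; ring
  · refine ⟨hi, hσ, hτ, Subtype.ext hε2, he, ?_, ?_⟩ <;> simp

end Existence

theorem exists_cyclicTrace_ne_zero {F : Type*} [Field F] [Finite F] {σ : F →+* F} {q : ℕ}
    (hq : 1 < q) (hσ : ∀ x, σ x = x ^ q) (hF : Nat.card F = q ^ 6) :
    ∃ u, cyclicTrace σ u ≠ 0 := by
  classical
  open Polynomial in
  by_contra! H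
  have := Fintype.ofFinite F
  let P : F[X] := ∑ j ∈ Finset.range 6, X ^ q ^ j
  have hdeg : P.natDegree < Fintype.card F := by
    rw [← Nat.card_eq_fintype_card, hF]
    refine lt_of_le_of_lt (natDegree_sum_le_of_forall_le (n := q ^ 5) _ _ fun j hj => ?_)
      (Nat.pow_lt_pow_right hq (by norm_num))
    rw [natDegree_X_pow]
    exact Nat.pow_le_pow_right hq.le (by have := Finset.mem_range.1 hj; omega)
  have hP : P = 0 := by
    refine eq_zero_of_natDegree_lt_card_of_eval_eq_zero P Function.injective_id
      (fun u => ?_) hdeg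
    have := H u
    simp only [cyclicTrace, hσ, ← pow_mul] at this
    simpa [P, Finset.sum_range_succ, pow_succ, eval_finsetSum] using this
  have hc : P.coeff 1 = 1 := by
    simp only [P, finsetSum_coeff, coeff_X_pow]
    rw [Finset.sum_eq_single_of_mem 0 (by simp)]
    · simp
    · intro j _ hj
      rw [if_neg (Nat.one_lt_pow hj hq).ne]
  simp [hP] at hc

theorem pow_three_pow_of_sq_eq_neg_one {R : Type*} [CommRing R] {i : R} (hi : i ^ 2 = -1) (n : ℕ) :
    i ^ 3 ^ n = (-1) ^ n * i := by
  induction n with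
  | zero => simp
  | succ n ih =>
    have h1 : ((-1 : R) ^ n) ^ 2 = 1 := by rw [← pow_mul, mul_comm, pow_mul]; simp
    rw [pow_succ, pow_mul, ih]
    linear_combination (-1) ^ n * i ^ 3 * h1 + (-1) ^ n * i * hi

section Points

variable {F : Type*} [Field F] [CharP F 3] {σ τ : F →+* F} {i e : F} {ε g d : fixedSubfield σ}

theorem IsReeFrame.isAbscissa_iff (f : IsReeFrame σ τ i e ε g d) (h : IsReePair σ τ) {φ : F → F}
    (hφ : ∀ x, τ (φ x) = σ x) (a : F) :
    IsAbscissa σ τ a ↔ (∃ b, σ b - b = φ a * (σ a - a)) ∧ ∃ c, σ c - c = φ a ^ 2 * (σ a - a) := by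
  rw [f.exists_sub_eq_iff h, f.exists_sub_eq_iff h, ← map_eq_zero τ,
    ← map_eq_zero τ (a := cyclicTrace σ (φ a ^ 2 * _)), map_cyclicTrace h, map_cyclicTrace h,
    map_mul, map_mul, map_pow, hφ, IsAbscissa, mul_comm (τ _), mul_comm (τ _)]

theorem IsReeFrame.card_points [Finite F] (f : IsReeFrame σ τ i e ε g d) (h : IsReePair σ τ)
    {φ : F → F} (hφ : ∀ x, τ (φ x) = σ x) :
    Nat.card {t : F × F × F // σ t.2.1 - t.2.1 = φ t.1 * (σ t.1 - t.1) ∧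
        σ t.2.2 - t.2.2 = φ t.1 ^ 2 * (σ t.1 - t.1)} =
      Nat.card {a // IsAbscissa σ τ a} * (Nat.card (fixedSubfield σ)) ^ 2 := by
  refine card_prod_eq_mul (R := fun a (p : F × F) => σ p.1 - p.1 = φ a * (σ a - a) ∧
    σ p.2 - p.2 = φ a ^ 2 * (σ a - a)) (P := IsAbscissa σ τ)
    (fun a p hp => (f.isAbscissa_iff h hφ a).2 ⟨⟨_, hp.1⟩, _, hp.2⟩) fun a ha => ?_
  obtain ⟨hb, hc⟩ := (f.isAbscissa_iff h hφ a).1 ha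
  rw [card_prod_eq_mul (R := fun b c => σ b - b = φ a * (σ a - a) ∧ σ c - c = φ a ^ 2 * (σ a - a))
    (P := fun b => σ b - b = φ a * (σ a - a)) (n := Nat.card (fixedSubfield σ))
    (fun _ _ H => H.1) fun b hb' => ?_, card_sub_fiber hb, sq]
  rw [← card_sub_fiber hc]
  exact Nat.card_congr (Equiv.subtypeEquivRight fun c => and_iff_right hb')

end Points

theorem ree_affine_points_over_Fq6 (s : ℕ) (hs : 0 < s) (q0 q : ℕ)
    (hq0 : q0 = 3 ^ s) (hq : q = 3 * q0 ^ 2)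
    (F : Type*) [Field F] [Fintype F] (hF : Fintype.card F = q ^ 6) :
    Nat.card {t : F × F × F // t.2.1 ^ q - t.2.1 = t.1 ^ q0 * (t.1 ^ q - t.1)
        ∧ t.2.2 ^ q - t.2.2 = t.1 ^ (2 * q0) * (t.1 ^ q - t.1)}
      = q ^ 6 + 3 * q0 * q ^ 3 * (q - 1) * (q + q0 + 1) := by
  have hq3 : q = 3 ^ (2 * s + 1) := by rw [hq, hq0]; ring
  have hp3 : 3 * q0 = 3 ^ (s + 1) := by rw [hq0]; ring
  have hq0pos : 1 < q0 := by rw [hq0]; exact Nat.one_lt_pow hs.ne' (by norm_num)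
  have hq1 : 1 < q := by nlinarith
  have : Fact (Nat.Prime 3) := ⟨Nat.prime_three⟩
  have : CharP F 3 := charP_of_card_eq_prime_pow (f := (2 * s + 1) * 6) (by rw [hF, hq3, pow_mul])
  let σ : F →+* F := iterateFrobenius F 3 (2 * s + 1)
  let τ : F →+* F := iterateFrobenius F 3 (s + 1)
  have hσ : ∀ x, σ x = x ^ q := fun x => by rw [hq3]; exact iterateFrobenius_def 3 _ x
  have hτ : ∀ x, τ x = x ^ (3 * q0) := fun x => by rw [hp3]; exact iterateFrobenius_def 3 _ x
  have hN : Nat.card F = q ^ 6 := by rw [Nat.card_eq_fintype_card, hF]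
  have h : IsReePair σ τ :=
    { comm := fun x => by simp only [hσ, hτ, ← pow_mul, mul_comm]
      sq := fun x => by
        simp only [hσ, hτ, ← pow_mul]
        congr 1
        rw [hq]
        ring
      six := fun x => by
        simp only [hσ, ← pow_mul]
        rw [show q * q * q * q * q * q = q ^ 6 by ring, ← hF, FiniteField.pow_card] }
  have hφ : ∀ x : F, τ (x ^ q0) = σ x := fun x => by
    rw [hτ, hσ, ← pow_mul, hq]
    congr 1
    ring
  obtain ⟨i, hi⟩ : IsSquare (-1 : F) := by
    rw [FiniteField.isSquare_neg_one_iff, hF, Nat.pow_mod]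
    have : q % 4 < 4 := Nat.mod_lt _ (by norm_num)
    interval_cases q % 4 <;> norm_num
  have hi2 : i ^ 2 = -1 := by rw [sq, hi]
  obtain ⟨e, ε, g, d, f⟩ := h.exists_frame (exists_cyclicTrace_ne_zero hq1 hσ hN) hi2
    (ε := (-1) ^ (s + 1))
    (by rw [hσ, hq3, pow_three_pow_of_sq_eq_neg_one hi2, Odd.neg_one_pow ⟨s, rfl⟩, neg_one_mul])
    (by rw [hτ, hp3, pow_three_pow_of_sq_eq_neg_one hi2])
    (by simp) (by rw [← pow_mul, mul_comm, pow_mul]; simp)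
  have hk : Nat.card (fixedSubfield σ) = q :=
    Nat.pow_left_injective (n := 6) (by norm_num) ((f.card_eq h).symm.trans hN)
  have hA := f.card_isAbscissa h hσ hτ (by nlinarith) (by rw [hq]; ring) hN hk
  have key := f.card_points h hφ
  simp only [hσ, ← pow_mul, mul_comm q0 2] at key
  rw [key, hA, hk]
  zify [hq1.le] at hq ⊢
  linear_combination (q ^ 3 * (q - 1) : ℤ) * hq
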